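/- arXiv:1909.01151 — 8 statements merged into one kernel-verified Lean document; each statement's English description precedes it below -/
import Mathlib

section
/- Let T > 0 and let λ : [0,T] → ℝ be continuous and twice continuously differentiable on [0,T), with |λ(T) − λ(t)| ≥ 4√(T−t) for all t ∈ [0,T). Assume that for every t ∈ [0,T): λ'(t) ≠ 0, λ''(t) ≠ 0, and the Loewner curvature LC_λ(t) = λ'(t)³/λ''(t) satisfies 9 ≤ LC_λ(t). Assume further that there exists δ > 0 such that for every s ∈ (0,T), inf_{t ∈ [s,T)} LC_λ(t) ≥ δ·√(T−s)·|λ'(s)|. If γ : [0,T) → ℂ is the simple trace driven by λ, then lim_{t→T} γ(t) exists and is a real number. -/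
open Set Complex Filter

noncomputable section

/-- A point `z` in the closed upper half-plane *survives* to time `t` under the
continuous real driving function `lam` if the chordal Loewner ODE
`g'(s) = 2 / (g s - lam s)`, `g 0 = z`, has a solution on `[0, t]` whose
denominator never vanishes. -/
def Survives (lam : ℝ → ℝ) (t : ℝ) (z : ℂ) : Prop :=
  ∃ g : ℝ → ℂ, g 0 = z ∧ ContinuousOn g (Icc 0 t) ∧
    ∀ s ∈ Icc (0:ℝ) t, g s ≠ (lam s : ℂ) ∧
      HasDerivWithinAt g (2 / (g s - (lam s : ℂ))) (Icc 0 t) s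

/-- The Loewner hull at time `t` driven by `lam`. -/
def LoewnerHull (lam : ℝ → ℝ) (t : ℝ) : Set ℂ :=
  { z : ℂ | 0 ≤ z.im ∧ ¬ Survives lam t z }

/-- `γ : [0,T) → ℂ` is the simple trace driven by `lam`. -/
def IsSimpleTrace (lam : ℝ → ℝ) (T : ℝ) (γ : ℝ → ℂ) : Prop :=
  ContinuousOn γ (Ico 0 T) ∧ InjOn γ (Ico 0 T) ∧ γ 0 = ((lam 0 : ℝ) : ℂ) ∧
    (∀ t ∈ Ioo (0:ℝ) T, 0 < (γ t).im) ∧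
    ∀ t ∈ Ico (0:ℝ) T, LoewnerHull lam t = γ '' Icc 0 t


/-- A differentiable real function with nonnegative derivative on an interval is increasing there. -/
lemma le_of_hasDerivWithinAt_nonneg {S : Set ℝ} {f f' : ℝ → ℝ} {a b : ℝ} (hab : a ≤ b)
    (hS : Icc a b ⊆ S) (hd : ∀ s ∈ Icc a b, HasDerivWithinAt f (f' s) S s)
    (hn : ∀ s ∈ Icc a b, 0 ≤ f' s) : f a ≤ f b := by
  have hder : ∀ s ∈ interior (Icc a b), HasDerivAt f (f' s) s := fun s hs =>
    (hd s (interior_subset hs)).hasDerivAt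
      (mem_of_superset (mem_interior_iff_mem_nhds.1 hs) hS)
  refine monotoneOn_of_deriv_nonneg (convex_Icc a b)
    (fun s hs => ((hd s hs).mono hS).continuousWithinAt)
    (fun s hs => (hder s hs).differentiableAt.differentiableWithinAt)
    (fun s hs => ?_) (left_mem_Icc.2 hab) (right_mem_Icc.2 hab) hab
  rw [(hder s hs).deriv]
  exact hn s (interior_subset hs)

/-- A differentiable real function that has negative derivative whenever it equals `c` cannot cross
the level `c` upwards. -/
lemma le_of_hasDerivWithinAt_neg_of_eq {S : Set ℝ} {f f' : ℝ → ℝ} {a b c : ℝ} (hab : a ≤ b)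
    (hS : Icc a b ⊆ S) (hd : ∀ s ∈ Icc a b, HasDerivWithinAt f (f' s) S s)
    (ha : f a ≤ c) (hn : ∀ s ∈ Icc a b, f s = c → f' s < 0) : f b ≤ c := by
  refine image_le_of_deriv_right_lt_deriv_boundary' (f := f) (f' := f') (B := fun _ => c)
    (B' := fun _ => 0) (fun s hs => ((hd s hs).mono hS).continuousWithinAt) (fun s hs => ?_) ha
    continuousOn_const (fun s _ => hasDerivWithinAt_const _ _ _)
    (fun s hs => hn s (Ico_subset_Icc_self hs)) (right_mem_Icc.2 hab)
  exact ((hd s (Ico_subset_Icc_self hs)).mono hS).mono_of_mem_nhdsWithin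
    (Icc_mem_nhdsGE_of_mem hs)

/-- `G` solves the chordal Loewner equation driven by `lam` on `[0, τ)`, started at `z`. -/
def IsFlow (lam : ℝ → ℝ) (τ : ℝ) (z : ℂ) (G : ℝ → ℂ) : Prop :=
  G 0 = z ∧ ∀ s ∈ Ico 0 τ, G s ≠ (lam s : ℂ) ∧
    HasDerivWithinAt G (2 / (G s - (lam s : ℂ))) (Ico 0 τ) s

/-- Solutions of the Loewner equation are determined by their starting point. -/
lemma loewner_unique {lam : ℝ → ℝ} {t : ℝ} (hlam : ContinuousOn lam (Icc 0 t)) {g h : ℝ → ℂ}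
    (h0 : g 0 = h 0)
    (hg : ∀ s ∈ Icc (0 : ℝ) t, g s ≠ (lam s : ℂ) ∧
      HasDerivWithinAt g (2 / (g s - (lam s : ℂ))) (Icc 0 t) s)
    (hh : ∀ s ∈ Icc (0 : ℝ) t, h s ≠ (lam s : ℂ) ∧
      HasDerivWithinAt h (2 / (h s - (lam s : ℂ))) (Icc 0 t) s) :
    ∀ s ∈ Icc (0 : ℝ) t, g s = h s := by
  have hgc : ContinuousOn g (Icc 0 t) := fun s hs => (hg s hs).2.continuousWithinAt
  have hhc : ContinuousOn h (Icc 0 t) := fun s hs => (hh s hs).2.continuousWithinAt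
  have hlc : ContinuousOn (fun s => (lam s : ℂ)) (Icc 0 t) :=
    continuous_ofReal.comp_continuousOn hlam
  have hk : ContinuousOn (fun s => -2 / ((g s - lam s) * (h s - lam s))) (Icc 0 t) :=
    continuousOn_const.div ((hgc.sub hlc).mul (hhc.sub hlc)) fun s hs =>
      mul_ne_zero (sub_ne_zero.2 (hg s hs).1) (sub_ne_zero.2 (hh s hs).1)
  obtain ⟨K, hK⟩ := isCompact_Icc.exists_bound_of_continuousOn hk
  intro s hs
  have key := norm_le_gronwallBound_of_norm_deriv_right_le (f := fun s => g s - h s)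
    (f' := fun s => 2 / (g s - lam s) - 2 / (h s - lam s)) (δ := 0) (K := K) (ε := 0)
    (hgc.sub hhc)
    (fun x hx => (((hg x (Ico_subset_Icc_self hx)).2.sub
      (hh x (Ico_subset_Icc_self hx)).2)).mono_of_mem_nhdsWithin (Icc_mem_nhdsGE_of_mem hx))
    (by simp [h0]) (fun x hx => by
      have hx' := Ico_subset_Icc_self hx
      have h1 := sub_ne_zero.2 (hg x hx').1
      have h2 := sub_ne_zero.2 (hh x hx').1
      have e : 2 / (g x - lam x) - 2 / (h x - lam x)
          = -2 / ((g x - lam x) * (h x - lam x)) * (g x - h x) := by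
        field_simp; ring
      rw [e, norm_mul, add_zero]
      exact mul_le_mul_of_nonneg_right (hK x hx') (norm_nonneg _)) s hs
  rw [gronwallBound_ε0_δ0] at key
  exact sub_eq_zero.1 (norm_le_zero_iff.1 key)

/-- A point surviving to every time before `τ` has a Loewner flow line on `[0, τ)`. -/
lemma exists_isFlow {lam : ℝ → ℝ} {τ : ℝ} (hτ : 0 < τ) (hlam : ContinuousOn lam (Ico 0 τ)) {z : ℂ}
    (hz : ∀ s ∈ Ico 0 τ, Survives lam s z) : ∃ G, IsFlow lam τ z G := by
  choose! g hg0 hgc hgd using hz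
  have heq : ∀ t ∈ Ico 0 τ, ∀ s ∈ Icc 0 t, g s s = g t s := by
    intro t ht s hs
    have hsub : Icc 0 s ⊆ Icc 0 t := Icc_subset_Icc_right hs.2
    have hsτ : s ∈ Ico 0 τ := ⟨hs.1, hs.2.trans_lt ht.2⟩
    refine loewner_unique (lam := lam) (t := s)
      (hlam.mono fun u hu => ⟨hu.1, hu.2.trans_lt hsτ.2⟩) ?_ (hgd s hsτ)
      (fun u hu => ⟨(hgd t ht u (hsub hu)).1, (hgd t ht u (hsub hu)).2.mono hsub⟩) s
      (right_mem_Icc.2 hs.1)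
    rw [hg0 s hsτ, hg0 t ht]
  refine ⟨fun s => g s s, hg0 0 ⟨le_rfl, hτ⟩, fun s hs => ⟨?_, ?_⟩⟩
  · exact (hgd s hs s (right_mem_Icc.2 hs.1)).1
  · obtain ⟨t, hst, htτ⟩ := exists_between hs.2
    have ht : t ∈ Ico 0 τ := ⟨hs.1.trans hst.le, htτ⟩
    have hd := (hgd t ht s ⟨hs.1, hst.le⟩).2
    have hmem : Icc 0 t ∈ nhdsWithin s (Ico 0 τ) := by
      filter_upwards [self_mem_nhdsWithin, mem_nhdsWithin_of_mem_nhds (Iio_mem_nhds hst)]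
        with u hu hu' using ⟨hu.1, le_of_lt hu'⟩
    have e := heq t ht s ⟨hs.1, hst.le⟩
    simp only [e]
    refine (hd.mono_of_mem_nhdsWithin hmem).congr_of_eventuallyEq ?_ e
    filter_upwards [hmem] with u hu using heq t ht u hu

/-- A flow line of a point which is swallowed at time `t` comes arbitrarily close to the driving
function before time `t`. -/
lemma IsFlow.exists_norm_lt {lam : ℝ → ℝ} {t : ℝ} (hlam : ContinuousOn lam (Icc 0 t))
    {z : ℂ} {G : ℝ → ℂ} (hG : IsFlow lam t z G) (hz : ¬ Survives lam t z) {s : ℝ}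
    (hs : s ∈ Ico 0 t) {ε : ℝ} (hε : 0 < ε) : ∃ u ∈ Ioo s t, ‖G u - lam u‖ < ε := by
  by_contra! hcon
  apply hz
  have hsub : Ioo s t ⊆ Ico 0 t := fun u hu => ⟨hs.1.trans hu.1.le, hu.2⟩
  have hderiv : ∀ u ∈ Ioo s t, HasDerivAt G (2 / (G u - lam u)) u := fun u hu =>
    (hG.2 u (hsub hu)).2.hasDerivAt (mem_of_superset (isOpen_Ioo.mem_nhds hu) hsub)
  have hlip : LipschitzOnWith (Real.toNNReal (2 / ε)) G (Ioo s t) := by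
    refine (convex_Ioo s t).lipschitzOnWith_of_nnnorm_hasDerivWithin_le
      (fun u hu => (hderiv u hu).hasDerivWithinAt) (fun u hu => ?_)
    rw [← NNReal.coe_le_coe, Real.coe_toNNReal _ (by positivity), coe_nnnorm, norm_div]
    simp only [norm_ofNat]
    exact div_le_div_of_nonneg_left (by norm_num) hε (hcon u hu)
  obtain ⟨g, hgl, hgeq⟩ := hlip.extend_finite_dimension
  have hgc := hgl.continuous
  have hne : nhdsWithin t (Iio t) = nhdsWithin t (Ioo s t) := (nhdsWithin_Ioo_eq_nhdsLT hs.2).symm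
  have hlt : Tendsto (fun u => (lam u : ℂ)) (nhdsWithin t (Iio t)) (nhds (lam t)) := by
    rw [hne]
    exact (continuous_ofReal.tendsto _).comp
      ((hlam t (right_mem_Icc.2 (hs.1.trans hs.2.le))).mono
        (fun u hu => Ico_subset_Icc_self (hsub hu)))
  have hgt : Tendsto g (nhdsWithin t (Iio t)) (nhds (g t)) :=
    (hgc.tendsto t).mono_left nhdsWithin_le_nhds
  have hIoo : Ioo s t ∈ nhdsWithin t (Iio t) := Ioo_mem_nhdsLT hs.2
  have hlim : ε ≤ ‖g t - lam t‖ := by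
    refine ge_of_tendsto (hgt.sub hlt).norm ?_
    filter_upwards [hIoo] with u hu
    rw [← hgeq hu]
    exact hcon u hu
  have hgne : g t ≠ lam t := by
    intro h
    rw [h] at hlim
    simp at hlim
    linarith
  set F : ℝ → ℂ := fun u => if u < t then G u else g t with hF
  have hFG : ∀ u, u < t → F u = G u := fun u hu => if_pos hu
  have hFt : F t = g t := if_neg (lt_irrefl t)
  have hFe : ∀ u, u < t → F =ᶠ[nhds u] G := fun u hu => by
    filter_upwards [Iio_mem_nhds hu] with v hv using hFG v hv
  have hall : ∀ u ∈ Icc 0 t, F u ≠ lam u ∧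
      HasDerivWithinAt F (2 / (F u - lam u)) (Icc 0 t) u := by
    intro u hu
    rcases hu.2.lt_or_eq with hut | rfl
    · rw [hFG u hut]
      refine ⟨(hG.2 u ⟨hu.1, hut⟩).1, ?_⟩
      refine HasDerivWithinAt.congr_of_eventuallyEq ?_
        ((hFe u hut).filter_mono nhdsWithin_le_nhds) (hFG u hut)
      refine (hG.2 u ⟨hu.1, hut⟩).2.mono_of_mem_nhdsWithin ?_
      filter_upwards [self_mem_nhdsWithin, mem_nhdsWithin_of_mem_nhds (Iio_mem_nhds hut)]
        with v hv hv' using ⟨hv.1, hv'⟩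
    · rw [hFt]
      refine ⟨hgne, ?_⟩
      have hFu : Tendsto F (nhdsWithin u (Iio u)) (nhds (g u)) := by
        refine hgt.congr' ?_
        filter_upwards [hIoo] with v hv
        rw [hFG v hv.2, hgeq hv]
      refine (hasDerivWithinAt_Iic_of_tendsto_deriv (s := Ioo s u) ?_ ?_ hIoo ?_).mono
        Icc_subset_Iic_self
      · intro v hv
        exact ((hderiv v hv).congr_of_eventuallyEq
          (hFe v hv.2)).differentiableAt.differentiableWithinAt
      · rw [ContinuousWithinAt, hFt, ← hne]
        exact hFu
      · refine ((tendsto_const_nhds (x := (2 : ℂ))).div (hFu.sub hlt)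
          (sub_ne_zero.2 hgne)).congr' ?_
        filter_upwards [hIoo] with v hv
        rw [((hderiv v hv).congr_of_eventuallyEq (hFe v hv.2)).deriv, Pi.div_apply, hFG v hv.2]
  exact ⟨F, by rw [hFG 0 (hs.1.trans_lt hs.2), hG.1],
    fun u hu => (hall u hu).2.continuousWithinAt, hall⟩

/-- An increasing driving function on `[0, T]` whose Loewner curvature is at least `9` and which
grows at least like `4 * √(T - t)` near the final time. -/
structure CurvedDriver (T : ℝ) (lam d1 d2 : ℝ → ℝ) : Prop where
  pos : 0 < T
  cont : ContinuousOn lam (Icc 0 T)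
  deriv : ∀ t ∈ Ico (0 : ℝ) T, HasDerivWithinAt lam (d1 t) (Ico 0 T) t
  deriv2 : ∀ t ∈ Ico (0 : ℝ) T, HasDerivWithinAt d1 (d2 t) (Ico 0 T) t
  growth : ∀ t ∈ Ico (0 : ℝ) T, 4 * Real.sqrt (T - t) ≤ lam T - lam t
  deriv_pos : ∀ t ∈ Ico (0 : ℝ) T, 0 < d1 t
  deriv2_nonneg : ∀ t ∈ Ico (0 : ℝ) T, 0 ≤ d2 t
  curvature : ∀ t ∈ Ico (0 : ℝ) T, 9 * d2 t ≤ d1 t ^ 3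

namespace CurvedDriver

variable {T : ℝ} {lam d1 d2 : ℝ → ℝ}

lemma lt_final (D : CurvedDriver T lam d1 d2) {t : ℝ} (ht : t ∈ Ico 0 T) : lam t < lam T := by
  have h := D.growth t ht
  have : 0 < Real.sqrt (T - t) := Real.sqrt_pos.2 (by linarith [ht.2])
  linarith

lemma deriv_mono (D : CurvedDriver T lam d1 d2) {s t : ℝ} (hs : 0 ≤ s) (hst : s ≤ t) (ht : t < T) :
    d1 s ≤ d1 t := by
  have hsub : Icc s t ⊆ Ico 0 T := fun u hu => ⟨hs.trans hu.1, hu.2.trans_lt ht⟩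
  exact le_of_hasDerivWithinAt_nonneg hst hsub (fun u hu => D.deriv2 u (hsub hu))
    (fun u hu => D.deriv2_nonneg u (hsub hu))

lemma mono (D : CurvedDriver T lam d1 d2) {s t : ℝ} (hs : 0 ≤ s) (hst : s ≤ t) (ht : t < T) :
    lam s ≤ lam t := by
  have hsub : Icc s t ⊆ Ico 0 T := fun u hu => ⟨hs.trans hu.1, hu.2.trans_lt ht⟩
  exact le_of_hasDerivWithinAt_nonneg hst hsub (fun u hu => D.deriv u (hsub hu))
    (fun u hu => (D.deriv_pos u (hsub hu)).le)

lemma sub_le_mul (D : CurvedDriver T lam d1 d2) {s t : ℝ} (hs : 0 ≤ s) (hst : s ≤ t) (ht : t < T)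
    {C : ℝ} (hC : d1 t ≤ C) : lam t - lam s ≤ C * (t - s) := by
  have hsub : Icc s t ⊆ Ico 0 T := fun u hu => ⟨hs.trans hu.1, hu.2.trans_lt ht⟩
  have := le_of_hasDerivWithinAt_nonneg (f := fun u => C * u - lam u) hst hsub
    (fun u hu => ((hasDerivWithinAt_id u _).const_mul C).sub (D.deriv u (hsub hu)))
    (fun u hu => by
      have := D.deriv_mono (hs.trans hu.1) hu.2 ht
      linarith)
  linarith

lemma tendsto_final (D : CurvedDriver T lam d1 d2) :
    Tendsto lam (nhdsWithin T (Iio T)) (nhds (lam T)) := by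
  rw [← nhdsWithin_Ioo_eq_nhdsLT D.pos]
  exact (D.cont T (right_mem_Icc.2 D.pos.le)).mono Ioo_subset_Icc_self

lemma exists_lt_deriv (D : CurvedDriver T lam d1 d2) (C : ℝ) : ∃ s ∈ Ico 0 T, C < d1 s := by
  by_contra! hcon
  have hle : ∀ s ∈ Ico 0 T, lam T - lam s ≤ C * (T - s) := by
    intro s hs
    have h1 : Tendsto (fun t => lam t - lam s) (nhdsWithin T (Iio T)) (nhds (lam T - lam s)) :=
      D.tendsto_final.sub_const _
    have h2 : Tendsto (fun t => C * (t - s)) (nhdsWithin T (Iio T)) (nhds (C * (T - s))) :=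
      (Continuous.tendsto (by fun_prop) T).mono_left nhdsWithin_le_nhds
    refine le_of_tendsto_of_tendsto h1 h2 ?_
    filter_upwards [Ioo_mem_nhdsLT hs.2] with t ht
    exact D.sub_le_mul hs.1 ht.1.le ht.2 (hcon t ⟨hs.1.trans ht.1.le, ht.2⟩)
  have hC : 0 < C := (D.deriv_pos 0 ⟨le_rfl, D.pos⟩).trans_le (hcon 0 ⟨le_rfl, D.pos⟩)
  set h := min T (1 / C ^ 2) with hh
  have hpos : 0 < h := lt_min D.pos (by positivity)
  have hmem : T - h ∈ Ico 0 T := ⟨by linarith [min_le_left T (1 / C ^ 2)], by linarith⟩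
  have h1 := D.growth _ hmem
  have h2 := hle _ hmem
  rw [sub_sub_cancel] at h1 h2
  have hr := Real.sqrt_pos.2 hpos
  have hsq := Real.sq_sqrt hpos.le
  have h3 : h * C ^ 2 ≤ 1 := by
    have := mul_le_mul_of_nonneg_right (min_le_right T (1 / C ^ 2)) (sq_nonneg C)
    rwa [one_div_mul_cancel (by positivity)] at this
  have h4 : 4 * √h ≤ C * √h * √h := by nlinarith
  have h5 : 4 ≤ C * √h := le_of_mul_le_mul_right h4 hr
  have h6 : (C * √h) ^ 2 ≤ 1 := by rw [mul_pow, hsq]; linarith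
  nlinarith

lemma inv_sq_le (D : CurvedDriver T lam d1 d2) {s t : ℝ} (hs : 0 ≤ s) (hst : s ≤ t) (ht : t < T) :
    1 / d1 s ^ 2 ≤ 1 / d1 t ^ 2 + 2 / 9 * (t - s) := by
  have hsub : Icc s t ⊆ Ico 0 T := fun u hu => ⟨hs.trans hu.1, hu.2.trans_lt ht⟩
  have := le_of_hasDerivWithinAt_nonneg (f := fun u => (d1 u ^ 2)⁻¹ + 2 / 9 * u) hst hsub
    (fun u hu => (((D.deriv2 u (hsub hu)).pow 2).inv
        (pow_ne_zero 2 (D.deriv_pos u (hsub hu)).ne')).add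
        ((hasDerivWithinAt_id u _).const_mul (2 / 9)))
    (fun u hu => by
      have h1 := D.deriv_pos u (hsub hu)
      have h2 := D.curvature u (hsub hu)
      have : -(2 * d1 u * d2 u) / (d1 u ^ 2) ^ 2 + 2 / 9
          = 2 / 9 * ((d1 u ^ 3 - 9 * d2 u) / d1 u ^ 3) := by
        field_simp; ring
      have h3 : 0 ≤ (d1 u ^ 3 - 9 * d2 u) / d1 u ^ 3 := div_nonneg (by linarith) (by positivity)
      simp only [Nat.cast_ofNat, Nat.reduceSub, pow_one, Pi.pow_apply, mul_one]
      linarith)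
  simp only [one_div]
  linarith

lemma le_mul_sq (D : CurvedDriver T lam d1 d2) {s : ℝ} (hs : s ∈ Ico 0 T) :
    9 ≤ 2 * (T - s) * d1 s ^ 2 := by
  have hp := D.deriv_pos s hs
  have key : 1 / d1 s ^ 2 ≤ 2 / 9 * (T - s) := by
    refine le_of_forall_pos_le_add fun ε hε => ?_
    obtain ⟨t, ht, hlt⟩ := D.exists_lt_deriv (1 + 1 / ε)
    set u := max s t
    have hu : u < T := max_lt hs.2 ht.2
    have h1 := D.inv_sq_le hs.1 (le_max_left s t) hu
    have h2 : 1 + 1 / ε < d1 u := hlt.trans_le (D.deriv_mono ht.1 (le_max_right s t) hu)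
    have hε' : 0 < 1 / ε := by positivity
    have h3 : 1 / d1 u ^ 2 ≤ ε := by
      rw [div_le_iff₀ (by nlinarith)]
      have : ε * (1 / ε) = 1 := by field_simp
      have h4 : 1 / ε ≤ d1 u ^ 2 := by nlinarith
      calc 1 = ε * (1 / ε) := this.symm
        _ ≤ ε * d1 u ^ 2 := mul_le_mul_of_nonneg_left h4 hε.le
    linarith
  rw [div_le_iff₀ (by positivity)] at key
  linarith

end CurvedDriver

/-- `R` is the Loewner flow line on `[0, T)` of a real point `x` to the right of `lam 0`. -/
def IsRealFlow (lam : ℝ → ℝ) (T x : ℝ) (R : ℝ → ℝ) : Prop :=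
  R 0 = x ∧ ∀ s ∈ Ico 0 T, lam s < R s ∧
    HasDerivWithinAt R (2 / (R s - lam s)) (Ico 0 T) s

lemma IsFlow.hasDerivWithinAt_re {lam : ℝ → ℝ} {τ : ℝ} {z : ℂ} {G : ℝ → ℂ} (hG : IsFlow lam τ z G)
    {s : ℝ} (hs : s ∈ Ico 0 τ) : HasDerivWithinAt (fun u => (G u).re)
      (2 * ((G s).re - lam s) / (((G s).re - lam s) ^ 2 + (G s).im ^ 2)) (Ico 0 τ) s := by
  have h := (reCLM.hasFDerivAt.comp_hasDerivWithinAt s (hG.2 s hs).2)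
  refine h.congr_deriv ?_
  simp [Complex.div_re, normSq_apply, sq]

lemma IsFlow.hasDerivWithinAt_im {lam : ℝ → ℝ} {τ : ℝ} {z : ℂ} {G : ℝ → ℂ} (hG : IsFlow lam τ z G)
    {s : ℝ} (hs : s ∈ Ico 0 τ) : HasDerivWithinAt (fun u => (G u).im)
      (-(2 * (G s).im / (((G s).re - lam s) ^ 2 + (G s).im ^ 2))) (Ico 0 τ) s := by
  have h := (imCLM.hasFDerivAt.comp_hasDerivWithinAt s (hG.2 s hs).2)
  refine h.congr_deriv ?_
  simp [Complex.div_im, normSq_apply, sq]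

lemma IsFlow.normSq_pos {lam : ℝ → ℝ} {τ : ℝ} {z : ℂ} {G : ℝ → ℂ} (hG : IsFlow lam τ z G)
    {s : ℝ} (hs : s ∈ Ico 0 τ) : 0 < ((G s).re - lam s) ^ 2 + (G s).im ^ 2 := by
  have h := Complex.normSq_pos.2 (sub_ne_zero.2 (hG.2 s hs).1)
  simpa [normSq_apply, sq] using h

/-- Flow lines of real points stay real. -/
lemma IsFlow.isRealFlow {lam : ℝ → ℝ} {T x : ℝ} {G : ℝ → ℂ} (hlam : ContinuousOn lam (Ico 0 T))
    (hx : lam 0 < x) (hG : IsFlow lam T x G) : IsRealFlow lam T x (fun s => (G s).re) := by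
  have him : ∀ s ∈ Ico 0 T, (G s).im = 0 := by
    intro s hs
    have hsub : Icc 0 s ⊆ Ico 0 T := fun u hu => ⟨hu.1, hu.2.trans_lt hs.2⟩
    have := le_of_hasDerivWithinAt_nonneg (f := fun u => -(G u).im ^ 2) hs.1 hsub
      (fun u hu => ((hG.hasDerivWithinAt_im (hsub hu)).pow 2).neg) (fun u hu => by
        have hp := hG.normSq_pos (hsub hu)
        set N := ((G u).re - lam u) ^ 2 + (G u).im ^ 2
        have : -((2 : ℕ) * (G u).im ^ (2 - 1) * -(2 * (G u).im / N)) = 4 * (G u).im ^ 2 / N := by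
          simp only [Nat.cast_ofNat, Nat.reduceSub, pow_one]; ring
        rw [this]
        positivity)
    rw [hG.1, ofReal_im] at this
    nlinarith
  have hlt : ∀ s ∈ Ico 0 T, lam s < (G s).re := by
    intro s hs
    by_contra! hle
    have hsub : Icc 0 s ⊆ Ico 0 T := fun u hu => ⟨hu.1, hu.2.trans_lt hs.2⟩
    have hc : ContinuousOn (fun u => (G u).re - lam u) (Icc 0 s) := fun u hu =>
      (((hG.hasDerivWithinAt_re (hsub hu)).continuousWithinAt).sub (hlam u (hsub hu))).mono hsub
    have h0 : (0 : ℝ) ∈ Icc ((G s).re - lam s) ((G 0).re - lam 0) := by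
      rw [hG.1, ofReal_re]; constructor <;> linarith
    obtain ⟨u, hu, hu0⟩ := intermediate_value_Icc' hs.1 hc h0
    have hp := hG.normSq_pos (hsub hu)
    simp only at hu0
    rw [hu0, him u (hsub hu)] at hp
    simp at hp
  refine ⟨by simp [hG.1], fun s hs => ⟨hlt s hs, ?_⟩⟩
  refine (hG.hasDerivWithinAt_re hs).congr_deriv ?_
  have h := sub_pos.2 (hlt s hs)
  rw [him s hs]
  field_simp
  ring

/-- The distance between two real flow lines decreases. -/
lemma IsRealFlow.abs_sub_le {lam : ℝ → ℝ} {T x y : ℝ} {R Q : ℝ → ℝ} (hR : IsRealFlow lam T x R)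
    (hQ : IsRealFlow lam T y Q) {s : ℝ} (hs : s ∈ Ico 0 T) : |R s - Q s| ≤ |x - y| := by
  have hsub : Icc 0 s ⊆ Ico 0 T := fun u hu => ⟨hu.1, hu.2.trans_lt hs.2⟩
  have := le_of_hasDerivWithinAt_nonneg (f := fun u => -(R u - Q u) ^ 2) hs.1 hsub
    (fun u hu => (((hR.2 u (hsub hu)).2.sub (hQ.2 u (hsub hu)).2).pow 2).neg) (fun u hu => by
      have h1 := sub_pos.2 (hR.2 u (hsub hu)).1
      have h2 := sub_pos.2 (hQ.2 u (hsub hu)).1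
      have : -((2 : ℕ) * (R - Q) u ^ (2 - 1) * (2 / (R u - lam u) - 2 / (Q u - lam u)))
          = 4 * (R u - Q u) ^ 2 / ((R u - lam u) * (Q u - lam u)) := by
        simp only [Pi.sub_apply, Nat.cast_ofNat, Nat.reduceSub, pow_one]
        field_simp
        ring
      rw [this]
      positivity)
  simp only [hR.1, hQ.1] at this
  exact sq_le_sq.1 (by linarith)

namespace CurvedDriver

variable {T : ℝ} {lam d1 d2 : ℝ → ℝ}

/-- Real points that come close to the driving function stay close to it. -/
lemma mul_sub_le_five (D : CurvedDriver T lam d1 d2) {x : ℝ} {R : ℝ → ℝ}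
    (hR : IsRealFlow lam T x R) {s u : ℝ} (hs : 0 ≤ s) (hsu : s ≤ u) (hu : u < T)
    (h : d1 s * (R s - lam s) ≤ 5) : d1 u * (R u - lam u) ≤ 5 := by
  have hsub : Icc s u ⊆ Ico 0 T := fun v hv => ⟨hs.trans hv.1, hv.2.trans_lt hu⟩
  refine le_of_hasDerivWithinAt_neg_of_eq (f := fun v => d1 v * (R v - lam v)) hsu hsub
    (fun v hv => (D.deriv2 v (hsub hv)).mul
      ((hR.2 v (hsub hv)).2.sub (D.deriv v (hsub hv)))) h (fun v hv h5 => ?_)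
  have hp := D.deriv_pos v (hsub hv)
  have hc := D.curvature v (hsub hv)
  have hX : R v - lam v = 5 / d1 v := by rw [← h5]; field_simp
  rw [hX]
  have h1 : d2 v * (5 / d1 v) ≤ d1 v ^ 2 * (5 / 9) := by
    rw [mul_div_assoc', div_le_iff₀ hp]
    nlinarith
  have h2 : d1 v * (2 / (5 / d1 v) - d1 v) = - (3 / 5) * d1 v ^ 2 := by
    field_simp; ring
  rw [h2]
  nlinarith

/-- There is a real flow line which reaches the driving function exactly at the final time, and
stays at distance at least `5 / d1` from it before. -/
lemma exists_apex (D : CurvedDriver T lam d1 d2)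
    (hflow : ∀ x, lam 0 < x → ∃ R, IsRealFlow lam T x R) :
    ∃ x P, IsRealFlow lam T x P ∧ (∀ s ∈ Ico 0 T, 5 ≤ d1 s * (P s - lam s)) ∧
      ∀ s ∈ Ico 0 T, P s ≤ lam T := by
  have h0T : (0 : ℝ) ∈ Ico 0 T := ⟨le_rfl, D.pos⟩
  have hd0 := D.deriv_pos 0 h0T
  choose! R hR using hflow
  set B : Set ℝ := {x | lam 0 < x ∧ ∀ s ∈ Ico 0 T, 5 ≤ d1 s * (R x s - lam s)} with hB
  have hlow : ∀ x ∈ B, lam 0 + 5 / d1 0 ≤ x := by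
    intro x hx
    have h := hx.2 0 h0T
    rw [(hR x hx.1).1] at h
    have : 5 / d1 0 ≤ x - lam 0 := by rw [div_le_iff₀ hd0]; linarith
    linarith
  have hbdd : BddBelow B := ⟨_, hlow⟩
  have hne : B.Nonempty := by
    have h5 : 0 < 5 / d1 0 := by positivity
    have hx : lam 0 < lam T + 5 / d1 0 := by linarith [D.lt_final h0T]
    refine ⟨lam T + 5 / d1 0, hx, fun s hs => ?_⟩
    have hsub : Icc 0 s ⊆ Ico 0 T := fun u hu => ⟨hu.1, hu.2.trans_lt hs.2⟩
    have hRx := hR _ hx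
    have hinc := le_of_hasDerivWithinAt_nonneg hs.1 hsub (fun u hu => (hRx.2 u (hsub hu)).2)
      (fun u hu => (div_pos two_pos (sub_pos.2 (hRx.2 u (hsub hu)).1)).le)
    rw [hRx.1] at hinc
    have h1 := D.deriv_mono le_rfl hs.1 hs.2
    have h2 : 5 / d1 0 ≤ R (lam T + 5 / d1 0) s - lam s := by linarith [D.lt_final hs]
    calc (5 : ℝ) = d1 0 * (5 / d1 0) := by field_simp
      _ ≤ _ := mul_le_mul h1 h2 h5.le (hd0.le.trans h1)
  set x0 := sInf B with hx0
  have hx0l : lam 0 + 5 / d1 0 ≤ x0 := le_csInf hne hlow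
  have hx0p : lam 0 < x0 := by
    have : 0 < 5 / d1 0 := by positivity
    linarith
  refine ⟨x0, R x0, hR x0 hx0p, fun s hs => ?_, fun s hs => ?_⟩
  · have hp := D.deriv_pos s hs
    refine le_of_forall_pos_le_add fun ε hε => ?_
    obtain ⟨x, hxB, hx⟩ := exists_lt_of_csInf_lt hne
      (show sInf B < x0 + ε / d1 s by have := div_pos hε hp; linarith)
    have h1 := (hR x hxB.1).abs_sub_le (hR x0 hx0p) hs
    have h2 : x0 ≤ x := csInf_le hbdd hxB
    rw [abs_of_nonneg (sub_nonneg.2 h2)] at h1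
    have h3 := (abs_le.1 h1).2
    have h4 := hxB.2 s hs
    have h5 : d1 s * (R x s - lam s) ≤ d1 s * (R x0 s - lam s + ε / d1 s) :=
      mul_le_mul_of_nonneg_left (by linarith) hp.le
    rw [mul_add, mul_div_cancel₀ _ hp.ne'] at h5
    linarith
  · refine le_of_forall_pos_le_add fun ε hε => ?_
    obtain ⟨x, hxl, hxr⟩ := exists_between (show max (lam 0) (x0 - ε / 2) < x0 from
      max_lt hx0p (by linarith))
    have hxp : lam 0 < x := (le_max_left _ _).trans_lt hxl
    have hxε : x0 - ε / 2 < x := (le_max_right _ _).trans_lt hxl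
    have hxB : x ∉ B := fun h => absurd (csInf_le hbdd h) (not_le.2 hxr)
    have : ∃ u ∈ Ico 0 T, d1 u * (R x u - lam u) < 5 := by
      by_contra! hcon
      exact hxB ⟨hxp, hcon⟩
    obtain ⟨u, hu, hu5⟩ := this
    obtain ⟨v, hv, hvε⟩ := D.exists_lt_deriv (10 / ε)
    set w := max s (max u v)
    have hw : w < T := max_lt hs.2 (max_lt hu.2 hv.2)
    have hsw : s ≤ w := le_max_left _ _
    have hw0 : w ∈ Ico 0 T := ⟨hs.1.trans hsw, hw⟩
    have h1 := D.mul_sub_le_five (hR x hxp) hu.1 ((le_max_left u v).trans (le_max_right s _)) hw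
      hu5.le
    have h2 := hvε.trans_le (D.deriv_mono hv.1 ((le_max_right u v).trans (le_max_right s _)) hw)
    have hsub : Icc s w ⊆ Ico 0 T := fun y hy => ⟨hs.1.trans hy.1, hy.2.trans_lt hw⟩
    have hinc := le_of_hasDerivWithinAt_nonneg hsw hsub
      (fun y hy => ((hR x hxp).2 y (hsub hy)).2)
      (fun y hy => (div_pos two_pos (sub_pos.2 ((hR x hxp).2 y (hsub hy)).1)).le)
    have hdist := (hR x0 hx0p).abs_sub_le (hR x hxp) hs
    rw [abs_of_nonneg (sub_nonneg.2 hxr.le)] at hdist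
    have h3 := (abs_le.1 hdist).2
    have h4 := D.lt_final hw0
    have h5 : R x w - lam w ≤ ε / 2 := by
      have hX := sub_pos.2 ((hR x hxp).2 w hw0).1
      have h6 : 10 / ε * (R x w - lam w) ≤ 5 :=
        (mul_le_mul_of_nonneg_right h2.le hX.le).trans h1
      rw [div_mul_eq_mul_div, div_le_iff₀ hε] at h6
      linarith
    linarith

/-- The flow line reaching the driving function at the final time has distance from it comparable
to the remaining increment of the driving function. -/
lemma mul_le_apex_sub (D : CurvedDriver T lam d1 d2) {x : ℝ} {P : ℝ → ℝ}
    (hP : IsRealFlow lam T x P) (h5 : ∀ s ∈ Ico 0 T, 5 ≤ d1 s * (P s - lam s)) {s : ℝ}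
    (hs : s ∈ Ico 0 T) : 3 / 5 * (lam T - lam s) ≤ P s - lam s := by
  have h1 : Tendsto (fun t => 3 / 5 * (lam t - lam s)) (nhdsWithin T (Iio T))
      (nhds (3 / 5 * (lam T - lam s))) := (D.tendsto_final.sub_const _).const_mul _
  refine le_of_tendsto h1 ?_
  filter_upwards [Ioo_mem_nhdsLT hs.2] with t ht
  have hsub : Icc s t ⊆ Ico 0 T := fun u hu => ⟨hs.1.trans hu.1, hu.2.trans_lt ht.2⟩
  have h2 := le_of_hasDerivWithinAt_nonneg (f := fun u => 2 / 5 * lam u - P u) ht.1.le hsub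
    (fun u hu => ((D.deriv u (hsub hu)).const_mul (2 / 5)).sub (hP.2 u (hsub hu)).2)
    (fun u hu => by
      have hX := sub_pos.2 (hP.2 u (hsub hu)).1
      have := h5 u (hsub hu)
      rw [sub_nonneg, div_le_iff₀ hX]
      linarith)
  linarith [(hP.2 t (hsub (right_mem_Icc.2 ht.1.le))).1]

/-- Bounds for the flow line of a point that is swallowed exactly at time `t`. -/
lemma swallowed_bounds (D : CurvedDriver T lam d1 d2) {t : ℝ} (ht : t ∈ Ioo 0 T) {z : ℂ}
    (hz : 0 < z.im) {G : ℝ → ℂ} (hG : IsFlow lam t z G) (hns : ¬ Survives lam t z) :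
    ∀ s ∈ Ico 0 t, 0 < (G s).im ∧ 0 ≤ (G s).re - lam s ∧ (G s).re ≤ lam t ∧
      (G s).im ^ 2 ≤ 4 * (t - s) ∧
      (d1 t ^ 2 * (t - s) ≤ 1 → 2 * (t - s) ≤ (G s).im ^ 2) := by
  have hT : Ico 0 t ⊆ Ico 0 T := Ico_subset_Ico_right ht.2.le
  have hlamt : ContinuousOn lam (Icc 0 t) := D.cont.mono (Icc_subset_Icc_right ht.2.le)
  have happ : ∀ s ∈ Ico 0 t, ∀ ε > 0, ∃ u ∈ Ioo s t,
      |(G u).re - lam u| < ε ∧ |(G u).im| < ε := by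
    intro s hs ε hε
    obtain ⟨u, hu, h⟩ := hG.exists_norm_lt hlamt hns hs hε
    refine ⟨u, hu, ?_, ?_⟩
    · simpa using (abs_re_le_norm (G u - lam u)).trans_lt h
    · simpa using (abs_im_le_norm (G u - lam u)).trans_lt h
  have hre : ∀ s ∈ Ico 0 t, 0 ≤ (G s).re - lam s := by
    intro s hs
    by_contra! hneg
    obtain ⟨u, hu, hur, -⟩ := happ s hs _ (neg_pos.2 hneg)
    have hsub : Icc s u ⊆ Ico 0 t := fun v hv => ⟨hs.1.trans hv.1, hv.2.trans_lt hu.2⟩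
    have := le_of_hasDerivWithinAt_neg_of_eq (f := fun v => (G v).re - lam v) hu.1.le hsub
      (fun v hv => (hG.hasDerivWithinAt_re (hsub hv)).sub
        ((D.deriv v (hT (hsub hv))).mono hT)) le_rfl (fun v hv hve => by
        have hN := hG.normSq_pos (hsub hv)
        have hp := D.deriv_pos v (hT (hsub hv))
        have : 2 * ((G v).re - lam v) / (((G v).re - lam v) ^ 2 + (G v).im ^ 2) ≤ 0 :=
          div_nonpos_of_nonpos_of_nonneg (by rw [hve]; linarith) hN.le
        linarith)
    linarith [neg_abs_le ((G u).re - lam u)]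
  have him : ∀ s ∈ Ico 0 t, (G s).im ≠ 0 := by
    intro s hs h0
    have hsub : Icc 0 s ⊆ Ico 0 t := fun u hu => ⟨hu.1, hu.2.trans_lt hs.2⟩
    have hc : ContinuousOn (fun v => 2 / (((G v).re - lam v) ^ 2 + (G v).im ^ 2)) (Icc 0 s) := by
      intro v hv
      have h1 := (hG.hasDerivWithinAt_re (hsub hv)).continuousWithinAt.mono hsub
      have h2 := (hG.hasDerivWithinAt_im (hsub hv)).continuousWithinAt.mono hsub
      have h3 := (D.deriv v (hT (hsub hv))).continuousWithinAt.mono (hsub.trans hT)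
      exact continuousWithinAt_const.div (((h1.sub h3).pow 2).add (h2.pow 2))
        (hG.normSq_pos (hsub hv)).ne'
    obtain ⟨K, hK⟩ := isCompact_Icc.exists_bound_of_continuousOn hc
    have := le_of_hasDerivWithinAt_nonneg (f := fun v => (G v).im ^ 2 * Real.exp (2 * K * v))
      hs.1 hsub
      (fun v hv => ((hG.hasDerivWithinAt_im (hsub hv)).pow 2).mul
        ((hasDerivWithinAt_id v _).const_mul (2 * K)).exp) (fun v hv => by
        have hk := (le_abs_self _).trans (hK v hv)
        set N := ((G v).re - lam v) ^ 2 + (G v).im ^ 2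
        have e : (2 : ℕ) * (G v).im ^ (2 - 1) * -(2 * (G v).im / N) * Real.exp (2 * K * v)
            + (G v).im ^ 2 * (Real.exp (2 * K * v) * (2 * K * 1))
            = 2 * (K - 2 / N) * ((G v).im ^ 2 * Real.exp (2 * K * v)) := by
          simp only [Nat.cast_ofNat, Nat.reduceSub, pow_one]; ring
        refine le_of_le_of_eq ?_ e.symm
        have : 0 ≤ K - 2 / N := by linarith
        positivity)
    simp only [hG.1, h0] at this
    norm_num at this
    nlinarith
  have himp : ∀ s ∈ Ico 0 t, 0 < (G s).im := by
    intro s hs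
    by_contra! hneg
    have hsub : Icc 0 s ⊆ Ico 0 t := fun u hu => ⟨hu.1, hu.2.trans_lt hs.2⟩
    have hc : ContinuousOn (fun u => (G u).im) (Icc 0 s) := fun u hu =>
      (hG.hasDerivWithinAt_im (hsub hu)).continuousWithinAt.mono hsub
    obtain ⟨u, hu, hu0⟩ := intermediate_value_Icc' hs.1 hc
      (show (0 : ℝ) ∈ Icc (G s).im (G 0).im from ⟨hneg, by rw [hG.1]; exact hz.le⟩)
    exact him u (hsub hu) hu0
  have hret : ∀ s ∈ Ico 0 t, (G s).re ≤ lam t := by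
    intro s hs
    refine le_of_forall_pos_le_add fun ε hε => ?_
    obtain ⟨u, hu, hur, -⟩ := happ s hs _ hε
    have hsub : Icc s u ⊆ Ico 0 t := fun v hv => ⟨hs.1.trans hv.1, hv.2.trans_lt hu.2⟩
    have h1 := le_of_hasDerivWithinAt_nonneg hu.1.le hsub
      (fun v hv => hG.hasDerivWithinAt_re (hsub hv)) (fun v hv =>
        div_nonneg (mul_nonneg two_pos.le (hre v (hsub hv))) (hG.normSq_pos (hsub hv)).le)
    have h2 := D.mono (hs.1.trans hu.1.le) hu.2.le ht.2
    linarith [le_abs_self ((G u).re - lam u)]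
  refine fun s hs => ⟨himp s hs, hre s hs, hret s hs, ?_, fun hst => ?_⟩
  · refine le_of_forall_pos_le_add fun ε hε => ?_
    obtain ⟨u, hu, -, hui⟩ := happ s hs (min 1 ε) (by positivity)
    have hsub : Icc s u ⊆ Ico 0 t := fun v hv => ⟨hs.1.trans hv.1, hv.2.trans_lt hu.2⟩
    have h1 := le_of_hasDerivWithinAt_nonneg (f := fun v => (G v).im ^ 2 + 4 * v) hu.1.le hsub
      (fun v hv => ((hG.hasDerivWithinAt_im (hsub hv)).pow 2).add
        ((hasDerivWithinAt_id v _).const_mul 4)) (fun v hv => by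
        have hN := hG.normSq_pos (hsub hv)
        simp only [Nat.cast_ofNat, Nat.reduceSub, pow_one]
        have : 2 * (G v).im * -(2 * (G v).im / (((G v).re - lam v) ^ 2 + (G v).im ^ 2)) + 4 * 1
            = 4 * ((G v).re - lam v) ^ 2 / (((G v).re - lam v) ^ 2 + (G v).im ^ 2) := by
          field_simp; ring
        rw [this]
        positivity)
    have h2 : (G u).im ^ 2 ≤ ε := by
      rw [← sq_abs]
      have h3 := hui.le.trans (min_le_left _ _)
      have h4 := hui.le.trans (min_le_right _ _)
      nlinarith [abs_nonneg (G u).im]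
    linarith [hu.2]
  · refine le_of_forall_pos_le_add fun ε hε => ?_
    obtain ⟨r, hr1, hr2⟩ := exists_between
      (show max s (t - ε / 4) < t from max_lt hs.2 (by linarith))
    have hsr : s < r := (le_max_left _ _).trans_lt hr1
    have hrε : t - ε / 4 < r := (le_max_right _ _).trans_lt hr1
    obtain ⟨u, hu, hur, -⟩ := happ r ⟨hs.1.trans hsr.le, hr2⟩ (min 1 (ε / 2)) (by positivity)
    have hsu : s < u := hsr.trans hu.1
    have hsub : Icc s u ⊆ Ico 0 t := fun v hv => ⟨hs.1.trans hv.1, hv.2.trans_lt hu.2⟩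
    have hp := D.deriv_pos t ⟨ht.1.le, ht.2⟩
    have h1 := le_of_hasDerivWithinAt_nonneg
      (f := fun v => ((G v).re - lam v) ^ 2 - (G v).im ^ 2 - 2 * v) hsu.le hsub
      (fun v hv => ((((hG.hasDerivWithinAt_re (hsub hv)).sub
        ((D.deriv v (hT (hsub hv))).mono hT)).pow 2).sub
        ((hG.hasDerivWithinAt_im (hsub hv)).pow 2)).sub
        ((hasDerivWithinAt_id v _).const_mul 2)) (fun v hv => by
        have hN := hG.normSq_pos (hsub hv)
        have hx := hre v (hsub hv)
        have hx2 := hret v (hsub hv)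
        simp only [Nat.cast_ofNat, Nat.reduceSub, pow_one, Pi.sub_apply]
        have e : 2 * ((G v).re - lam v) * (2 * ((G v).re - lam v) /
            (((G v).re - lam v) ^ 2 + (G v).im ^ 2) - d1 v) - 2 * (G v).im *
            -(2 * (G v).im / (((G v).re - lam v) ^ 2 + (G v).im ^ 2)) - 2 * 1
            = 2 - 2 * d1 v * ((G v).re - lam v) := by
          field_simp; ring
        rw [e]
        have h2 := D.sub_le_mul (hsub hv).1 (hsub hv).2.le ht.2 le_rfl
        have h3 := D.deriv_mono (hsub hv).1 (hsub hv).2.le ht.2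
        have h4 : d1 v * ((G v).re - lam v) ≤ d1 t * (d1 t * (t - s)) :=
          mul_le_mul h3 (by nlinarith [hv.1]) hx hp.le
        nlinarith)
    have h2 : ((G u).re - lam u) ^ 2 ≤ ε / 2 := by
      rw [← sq_abs]
      have h3 := hur.le.trans (min_le_left _ _)
      have h4 := hur.le.trans (min_le_right _ _)
      nlinarith [abs_nonneg ((G u).re - lam u)]
    nlinarith [hu.1, sq_nonneg ((G s).re - lam s), sq_nonneg (G u).im]

end CurvedDriver

namespace CurvedDriver

variable {T : ℝ} {lam d1 d2 : ℝ → ℝ}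

/-- Points away from the driving function, on the scale given by its derivative, were always away
from it. -/
lemma sixteen_le_of_lt (D : CurvedDriver T lam d1 d2) {t : ℝ} (htT : t ≤ T) {z : ℂ} {G : ℝ → ℂ}
    (hG : IsFlow lam t z G) (hre : ∀ s ∈ Ico 0 t, 0 ≤ (G s).re - lam s) {s u : ℝ} (hs : 0 ≤ s)
    (hsu : s ≤ u) (hu : u < t)
    (h : 16 < d1 u ^ 2 * (((G u).re - lam u) ^ 2 + (G u).im ^ 2)) :
    16 ≤ d1 s ^ 2 * (((G s).re - lam s) ^ 2 + (G s).im ^ 2) := by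
  by_contra! hlt
  have hT : Ico 0 t ⊆ Ico 0 T := Ico_subset_Ico_right htT
  have hsub : Icc s u ⊆ Ico 0 t := fun v hv => ⟨hs.trans hv.1, hv.2.trans_lt hu⟩
  refine absurd (le_of_hasDerivWithinAt_neg_of_eq
    (f := fun v => d1 v ^ 2 * (((G v).re - lam v) ^ 2 + (G v).im ^ 2)) hsu hsub
    (fun v hv => (((D.deriv2 v (hT (hsub hv))).mono hT).pow 2).mul
      ((((hG.hasDerivWithinAt_re (hsub hv)).sub ((D.deriv v (hT (hsub hv))).mono hT)).pow 2).add
        ((hG.hasDerivWithinAt_im (hsub hv)).pow 2))) hlt.le (fun v hv h16 => ?_)) (not_le.2 h)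
  have hN := hG.normSq_pos (hsub hv)
  have hp := D.deriv_pos v (hT (hsub hv))
  have hc := D.curvature v (hT (hsub hv))
  have hx := hre v (hsub hv)
  simp only [Nat.cast_ofNat, Nat.reduceSub, pow_one, Pi.sub_apply, Pi.add_apply, Pi.pow_apply]
  set x := (G v).re - lam v
  set y := (G v).im
  set l := d1 v
  have h1 : 2 * l * d2 v * (x ^ 2 + y ^ 2) ≤ 32 / 9 * l ^ 2 := by
    have e : 2 * l * (l ^ 3 / 9) * (x ^ 2 + y ^ 2) = 32 / 9 * l ^ 2 := by
      linear_combination (2 / 9 * l ^ 2) * h16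
    rw [← e]
    gcongr
    linarith
  have h2 : l ^ 2 * (2 * x * (2 * x / (x ^ 2 + y ^ 2) - l) + 2 * y * -(2 * y / (x ^ 2 + y ^ 2)))
      = l ^ 2 * ((l * x) ^ 2 / 2 - 4 - 2 * (l * x)) := by
    have hl : l ^ 2 = 16 / (x ^ 2 + y ^ 2) := by rw [← h16]; field_simp
    rw [mul_pow, hl]
    field_simp
    ring
  rw [h2]
  have h3 : 0 ≤ l * x := mul_nonneg hp.le hx
  have h4 : l * x ≤ 4 := by
    have : (l * x) ^ 2 ≤ 4 ^ 2 := by nlinarith [sq_nonneg (l * y)]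
    nlinarith
  have h5 : 32 / 9 + ((l * x) ^ 2 / 2 - 4 - 2 * (l * x)) < 0 := by nlinarith
  nlinarith [pow_pos hp 2]

/-- A swallowed point cannot stay close to the driving function for a long time. -/
lemma sub_le_of_le_sixteen (D : CurvedDriver T lam d1 d2) {t : ℝ} (htT : t ≤ T) {z : ℂ}
    {G : ℝ → ℂ} (hG : IsFlow lam t z G) (him : ∀ s ∈ Ico 0 t, 0 < (G s).im) {s u : ℝ} (hs : 0 ≤ s)
    (hsu : s ≤ u) (hu : u < t) (h1 : 1 ≤ d1 u * (G u).im)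
    (h : ∀ v ∈ Icc s u, d1 v ^ 2 * (((G v).re - lam v) ^ 2 + (G v).im ^ 2) ≤ 16) :
    T - s ≤ 4 ^ 16 * (T - u) := by
  have hT : Ico 0 t ⊆ Ico 0 T := Ico_subset_Ico_right htT
  have hsub : Icc s u ⊆ Ico 0 t := fun v hv => ⟨hs.trans hv.1, hv.2.trans_lt hu⟩
  have hTv : ∀ v ∈ Icc s u, 0 < T - v := fun v hv => sub_pos.2 (hT (hsub hv)).2
  have hm : ∀ v ∈ Icc s u, 0 < d1 v * (G v).im := fun v hv =>
    mul_pos (D.deriv_pos v (hT (hsub hv))) (him v (hsub hv))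
  have key := le_of_hasDerivWithinAt_nonneg
    (f := fun v => Real.log (T - v) - 16 * Real.log (d1 v * (G v).im)) hsu hsub
    (fun v hv => (((hasDerivWithinAt_id v _).const_sub T).log (hTv v hv).ne').sub
      (((((D.deriv2 v (hT (hsub hv))).mono hT).mul (hG.hasDerivWithinAt_im (hsub hv))).log
        (hm v hv).ne').const_mul 16)) (fun v hv => by
      have hN := hG.normSq_pos (hsub hv)
      have hp := D.deriv_pos v (hT (hsub hv))
      have hc := D.curvature v (hT (hsub hv))
      have hy := him v (hsub hv)
      have h16 := h v hv
      have h9 := D.le_mul_sq (hT (hsub hv))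
      have hTv' := hTv v hv
      simp only [Pi.mul_apply, id_eq]
      set N := ((G v).re - lam v) ^ 2 + (G v).im ^ 2
      have e : (d2 v * (G v).im + d1 v * -(2 * (G v).im / N)) / (d1 v * (G v).im)
          = d2 v / d1 v - 2 / N := by
        field_simp
        ring
      rw [e]
      have a1 : d2 v / d1 v ≤ d1 v ^ 2 / 9 := by
        rw [div_le_div_iff₀ hp (by norm_num)]
        nlinarith
      have a2 : d1 v ^ 2 / 8 ≤ 2 / N := by
        rw [div_le_div_iff₀ (by norm_num) hN]
        linarith
      have a3 : -1 / (T - v) ≥ - (2 / 9) * d1 v ^ 2 := by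
        rw [ge_iff_le, le_div_iff₀ hTv']
        nlinarith
      linarith)
  have hm4 : Real.log (d1 s * (G s).im) ≤ Real.log 4 := by
    have hmem := left_mem_Icc.2 hsu
    refine Real.log_le_log (hm s hmem) ?_
    have := h s hmem
    nlinarith [hm s hmem, sq_nonneg (d1 s * ((G s).re - lam s))]
  have hm1 : 0 ≤ Real.log (d1 u * (G u).im) := Real.log_nonneg h1
  have hle : Real.log (T - s) ≤ Real.log (4 ^ 16 * (T - u)) := by
    rw [Real.log_mul (by norm_num) (hTv u (right_mem_Icc.2 hsu)).ne', Real.log_pow]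
    push_cast
    linarith
  exact (Real.log_le_log_iff (hTv s (left_mem_Icc.2 hsu))
    (by have := hTv u (right_mem_Icc.2 hsu); positivity)).1 hle

/-- The algebraic inequality behind the contraction of the hyperbolic metric of the right
half-plane under the backward Loewner flow. -/
lemma contraction_aux {l x y p : ℝ} (hl : 0 < l) (hx : 0 ≤ x) (hp : 0 < p) (hlp : 5 ≤ l * p)
    (hN : 16 ≤ l ^ 2 * (x ^ 2 + y ^ 2)) :
    l / 10 * p * (x ^ 2 + y ^ 2) * (x + p) ≤
      l * p * (x + p) * (x ^ 2 + y ^ 2) - 2 * x * ((x + p) ^ 2 + y ^ 2) := by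
  set R := Real.sqrt (x ^ 2 + y ^ 2) with hR
  have hR0 : 0 ≤ R := Real.sqrt_nonneg _
  have hR2 : R ^ 2 = x ^ 2 + y ^ 2 := Real.sq_sqrt (by positivity)
  have hm : (x + p) ^ 2 + y ^ 2 = R ^ 2 + 2 * x * p + p ^ 2 := by rw [hR2]; ring
  rw [hm, ← hR2]
  rw [← hR2, ← mul_pow] at hN
  have h4 : 4 ≤ l * R := by nlinarith [mul_nonneg hl.le hR0]
  have hxR : x ≤ R := Real.le_sqrt_of_sq_le (by nlinarith [sq_nonneg y])
  have t1 : 2 * x * R ^ 2 ≤ 2 / 5 * (l * p) * (x * R ^ 2) := by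
    have : 0 ≤ x * R ^ 2 := by positivity
    nlinarith
  have t2 : 2 * x ^ 2 * p ≤ 1 / 2 * (l * R) * (x * R * p) := by
    have a : x ^ 2 * p ≤ x * R * p := by nlinarith [mul_nonneg hx hp.le]
    have : 0 ≤ x * R * p := by positivity
    nlinarith
  have t3 : 2 * x ^ 2 * p ≤ 2 / 5 * (l * p) * (R ^ 2 * p) := by
    have a : x ^ 2 * p ≤ R ^ 2 * p := mul_le_mul_of_nonneg_right (by nlinarith) hp.le
    have : 0 ≤ R ^ 2 * p := by positivity
    nlinarith
  have t4 : 2 * x * p ^ 2 ≤ 1 / 2 * (l * R) * (R * p ^ 2) := by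
    have a : x * p ^ 2 ≤ R * p ^ 2 := mul_le_mul_of_nonneg_right hxR (by positivity)
    have : 0 ≤ R * p ^ 2 := by positivity
    nlinarith
  nlinarith

/-- The inequality of `contraction_aux` in terms of logarithmic derivatives. -/
lemma log_deriv_aux {l x y p Λ : ℝ} (hl : 0 < l) (hx : 0 ≤ x) (hp : 0 < p) (hlp : 5 ≤ l * p)
    (hN : 16 ≤ l ^ 2 * (x ^ 2 + y ^ 2)) (hΛ : 0 < Λ) (hn : 0 < (x - p) ^ 2 + y ^ 2)
    (hm : 0 < (x + p) ^ 2 + y ^ 2) (hmΛ : (x + p) ^ 2 + y ^ 2 ≤ 17 / 4 * Λ ^ 2)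
    (hpΛ : 3 / 5 * Λ ≤ p) :
    1 / 20 * (l / Λ) ≤ (2 * (x - p) * (2 * x / (x ^ 2 + y ^ 2) - 2 / p) +
        2 * y * -(2 * y / (x ^ 2 + y ^ 2))) / ((x - p) ^ 2 + y ^ 2) -
      (2 * (x + p) * (2 * x / (x ^ 2 + y ^ 2) + 2 / p - 2 * l) +
        2 * y * -(2 * y / (x ^ 2 + y ^ 2))) / ((x + p) ^ 2 + y ^ 2) := by
  have hN0 : 0 < x ^ 2 + y ^ 2 := by
    by_contra! h
    nlinarith [pow_pos hl 2]
  have e : (2 * (x - p) * (2 * x / (x ^ 2 + y ^ 2) - 2 / p) +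
        2 * y * -(2 * y / (x ^ 2 + y ^ 2))) / ((x - p) ^ 2 + y ^ 2) -
      (2 * (x + p) * (2 * x / (x ^ 2 + y ^ 2) + 2 / p - 2 * l) +
        2 * y * -(2 * y / (x ^ 2 + y ^ 2))) / ((x + p) ^ 2 + y ^ 2) =
      4 * (l * p * (x + p) * (x ^ 2 + y ^ 2) - 2 * x * ((x + p) ^ 2 + y ^ 2)) /
        (p * (x ^ 2 + y ^ 2) * ((x + p) ^ 2 + y ^ 2)) := by
    field_simp
    ring
  rw [e]
  refine le_trans ?_ (div_le_div_of_nonneg_right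
    (mul_le_mul_of_nonneg_left (contraction_aux hl hx hp hlp hN) (by norm_num : (0 : ℝ) ≤ 4))
    (by positivity))
  have e3 : 4 * (l / 10 * p * (x ^ 2 + y ^ 2) * (x + p)) /
      (p * (x ^ 2 + y ^ 2) * ((x + p) ^ 2 + y ^ 2))
      = 2 / 5 * l * (x + p) / ((x + p) ^ 2 + y ^ 2) := by
    field_simp
    ring
  rw [e3, mul_div_assoc', div_le_div_iff₀ hΛ hm]
  have c1 : 1 / 20 * l * ((x + p) ^ 2 + y ^ 2) ≤ 1 / 20 * l * (17 / 4 * Λ ^ 2) :=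
    mul_le_mul_of_nonneg_left hmΛ (by positivity)
  have c2 : 2 / 5 * l * (3 / 5 * Λ) * Λ ≤ 2 / 5 * l * (x + p) * Λ := by
    gcongr
    linarith
  nlinarith [mul_pos hl (pow_pos hΛ 2)]

/-- A point swallowed shortly before the final time is close to the starting point of the real
flow line which reaches the driving function at the final time. -/
lemma norm_sub_sq_le (D : CurvedDriver T lam d1 d2) {x₀ : ℝ} {P : ℝ → ℝ}
    (hP : IsRealFlow lam T x₀ P) (h5 : ∀ s ∈ Ico 0 T, 5 ≤ d1 s * (P s - lam s))
    (hPT : ∀ s ∈ Ico 0 T, P s ≤ lam T) {τ t : ℝ} (hτ : 0 < τ) (ht : t ∈ Ioo 0 T)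
    (hτt : 2 * 4 ^ 16 * (T - t) < T - τ) {z : ℂ} (hz : 0 < z.im) {G : ℝ → ℂ}
    (hG : IsFlow lam t z G) (hns : ¬ Survives lam t z) :
    ‖z - x₀‖ ^ 2 ≤ 5 * (lam T - lam 0) ^ 2 *
      Real.exp (1 / 20 * (Real.log (lam T - lam τ) - Real.log (lam T - lam 0))) := by
  have hT : Ico 0 t ⊆ Ico 0 T := Ico_subset_Ico_right ht.2.le
  have hb := D.swallowed_bounds ht hz hG hns
  have htT : t ∈ Ico 0 T := ⟨ht.1.le, ht.2⟩
  have hl := D.deriv_pos t htT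
  have hTt : 0 < T - t := sub_pos.2 ht.2
  obtain ⟨σ, hσ⟩ : ∃ σ, σ = 1 / d1 t ^ 2 := ⟨_, rfl⟩
  have hσ0 : 0 < σ := by rw [hσ]; positivity
  have hσ1 : d1 t ^ 2 * σ = 1 := by rw [hσ]; field_simp
  have hσ2 : 9 * σ ≤ 2 * (T - t) := by
    have := mul_le_mul_of_nonneg_right (D.le_mul_sq htT) hσ0.le
    calc 9 * σ ≤ 2 * (T - t) * d1 t ^ 2 * σ := this
      _ = 2 * (T - t) * (d1 t ^ 2 * σ) := by ring
      _ = _ := by rw [hσ1, mul_one]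
  have hs0τ : τ ≤ t - σ := by linarith
  have hs0 : t - σ ∈ Ico 0 t := ⟨by linarith, by linarith⟩
  have hm0 : 1 ≤ d1 (t - σ) * (G (t - σ)).im := by
    obtain ⟨hy, -, -, -, h2⟩ := hb _ hs0
    rw [sub_sub_cancel] at h2
    have h2 := h2 hσ1.le
    have h3 := D.inv_sq_le hs0.1 hs0.2.le ht.2
    rw [← hσ, sub_sub_cancel] at h3
    have hp := D.deriv_pos _ (hT hs0)
    rw [div_le_iff₀ (by positivity)] at h3
    have h4 : 1 ≤ (d1 (t - σ) * (G (t - σ)).im) ^ 2 := by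
      rw [mul_pow]
      nlinarith [pow_pos hp 2]
    have := mul_pos hp hy
    nlinarith
  obtain ⟨s₁, hs₁, h16⟩ : ∃ s₁ ∈ Icc τ (t - σ),
      16 < d1 s₁ ^ 2 * (((G s₁).re - lam s₁) ^ 2 + (G s₁).im ^ 2) := by
    by_contra! hcon
    have := D.sub_le_of_le_sixteen ht.2.le hG (fun s hs => (hb s hs).1) hτ.le hs0τ hs0.2 hm0 hcon
    nlinarith
  have hs₁t : s₁ < t := hs₁.2.trans_lt hs0.2
  have hs₁0 : 0 ≤ s₁ := hτ.le.trans hs₁.1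
  have hsub : Icc 0 s₁ ⊆ Ico 0 t := fun v hv => ⟨hv.1, hv.2.trans_lt hs₁t⟩
  have hn : ∀ v ∈ Icc 0 s₁, 0 < ((G v).re - P v) ^ 2 + (G v).im ^ 2 := fun v hv => by
    have := (hb v (hsub hv)).1
    positivity
  have hm : ∀ v ∈ Icc 0 s₁, 0 < ((G v).re + P v - 2 * lam v) ^ 2 + (G v).im ^ 2 := fun v hv => by
    have := (hb v (hsub hv)).1
    positivity
  have hΛ : ∀ v ∈ Icc 0 s₁, 0 < lam T - lam v := fun v hv =>
    sub_pos.2 (D.lt_final (hT (hsub hv)))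
  have hmle : ∀ v ∈ Icc 0 s₁, ((G v).re + P v - 2 * lam v) ^ 2 + (G v).im ^ 2 ≤
      17 / 4 * (lam T - lam v) ^ 2 := fun v hv => by
    have hvT := hT (hsub hv)
    obtain ⟨-, hx, hx2, hy2, -⟩ := hb v (hsub hv)
    have hp1 := sub_pos.2 (hP.2 v hvT).1
    have hp2 := hPT v hvT
    have hΛv := hΛ v hv
    have hlt := D.lt_final htT
    have hg := D.growth v hvT
    have hsq := Real.sq_sqrt (sub_pos.2 hvT.2).le
    have a1 : ((G v).re + P v - 2 * lam v) ^ 2 ≤ (2 * (lam T - lam v)) ^ 2 :=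
      pow_le_pow_left₀ (by linarith) (by linarith) 2
    have a2 : (4 * √(T - v)) ^ 2 ≤ (lam T - lam v) ^ 2 :=
      pow_le_pow_left₀ (by positivity) hg 2
    rw [mul_pow, hsq] at a2
    linarith [ht.2]
  have key := le_of_hasDerivWithinAt_nonneg
    (f := fun v => Real.log (((G v).re - P v) ^ 2 + (G v).im ^ 2)
      - Real.log (((G v).re + P v - 2 * lam v) ^ 2 + (G v).im ^ 2)
      + 1 / 20 * Real.log (lam T - lam v)) hs₁0 hsub
    (fun v hv => by
      have hre := hG.hasDerivWithinAt_re (hsub hv)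
      have him := (hG.hasDerivWithinAt_im (hsub hv)).pow 2
      have hl' := (D.deriv v (hT (hsub hv))).mono hT
      have hP' := (hP.2 v (hT (hsub hv))).2.mono hT
      exact (((((hre.sub hP').pow 2).add him).log (hn v hv).ne').sub
        (((((hre.add hP').sub (hl'.const_mul 2)).pow 2).add him).log (hm v hv).ne')).add
        (((hl'.const_sub (lam T)).log (hΛ v hv).ne').const_mul (1 / 20)))
    (fun v hv => by
      have hvT := hT (hsub hv)
      have hN := hG.normSq_pos (hsub hv)
      have hl' := D.deriv_pos v hvT
      obtain ⟨-, hx, -, -, -⟩ := hb v (hsub hv)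
      have hp := sub_pos.2 (hP.2 v hvT).1
      have hlp := h5 v hvT
      have hp35 := D.mul_le_apex_sub hP h5 hvT
      have hr := D.sixteen_le_of_lt ht.2.le hG (fun s hs => (hb s hs).2.1) hv.1 hv.2 hs₁t h16
      have hn' := hn v hv
      have hm' := hm v hv
      have hml := hmle v hv
      have hΛv := hΛ v hv
      have e1 : (G v).re - P v = ((G v).re - lam v) - (P v - lam v) := by ring
      have e2 : (G v).re + P v - 2 * lam v = ((G v).re - lam v) + (P v - lam v) := by ring
      simp only [Nat.cast_ofNat, Nat.reduceSub, pow_one, Pi.sub_apply, Pi.add_apply,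
        Pi.pow_apply]
      rw [e1] at hn'
      rw [e2] at hm' hml
      rw [e1, e2]
      set x := (G v).re - lam v
      set y := (G v).im
      set p := P v - lam v
      set l := d1 v
      set Λ := lam T - lam v
      have b := log_deriv_aux hl' hx hp hlp hr hΛv hn' hm' hml (by linarith)
      rw [neg_div]
      linarith)
  have hmem0 := left_mem_Icc.2 hs₁0
  have hmem1 := right_mem_Icc.2 hs₁0
  have hl1 : Real.log (((G s₁).re - P s₁) ^ 2 + (G s₁).im ^ 2)
      ≤ Real.log (((G s₁).re + P s₁ - 2 * lam s₁) ^ 2 + (G s₁).im ^ 2) := by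
    refine Real.log_le_log (hn s₁ hmem1) ?_
    have hx := (hb s₁ (hsub hmem1)).2.1
    have hp := sub_pos.2 (hP.2 s₁ (hT (hsub hmem1))).1
    nlinarith [mul_nonneg hx hp.le]
  have hl2 : Real.log (lam T - lam s₁) ≤ Real.log (lam T - lam τ) :=
    Real.log_le_log (hΛ s₁ hmem1) (by linarith [D.mono hτ.le hs₁.1 (hs₁t.trans ht.2)])
  have hfin : Real.log (((G 0).re - P 0) ^ 2 + (G 0).im ^ 2) ≤
      Real.log (5 * (lam T - lam 0) ^ 2) +
        1 / 20 * (Real.log (lam T - lam τ) - Real.log (lam T - lam 0)) := by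
    have : Real.log (((G 0).re + P 0 - 2 * lam 0) ^ 2 + (G 0).im ^ 2) ≤
        Real.log (5 * (lam T - lam 0) ^ 2) :=
      Real.log_le_log (hm 0 hmem0) ((hmle 0 hmem0).trans
        (by nlinarith [sq_nonneg (lam T - lam 0)]))
    linarith
  rw [Real.log_le_iff_le_exp (hn 0 hmem0), Real.exp_add,
    Real.exp_log (by have := hΛ 0 hmem0; positivity), hG.1, hP.1] at hfin
  rw [← normSq_eq_norm_sq, normSq_apply]
  simpa [sq] using hfin

/-- The trace of an increasing curved driving function ends at a real point. -/
lemma exists_tendsto (D : CurvedDriver T lam d1 d2) {γ : ℝ → ℂ} (hγ : IsSimpleTrace lam T γ) :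
    ∃ L : ℝ, Tendsto γ (nhdsWithin T (Iio T)) (nhds ((L : ℝ) : ℂ)) := by
  obtain ⟨-, hinj, h0, him, hhull⟩ := hγ
  have hlam : ContinuousOn lam (Ico 0 T) := D.cont.mono Ico_subset_Icc_self
  have hsurv : ∀ s ∈ Ico 0 T, ∀ z : ℂ, 0 ≤ z.im → z ∉ γ '' Icc 0 s → Survives lam s z := by
    intro s hs z hz hzγ
    by_contra hcon
    exact hzγ (hhull s hs ▸ ⟨hz, hcon⟩)
  obtain ⟨x₀, P, hP, h5, hPT⟩ := D.exists_apex fun x hx => by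
    obtain ⟨G, hG⟩ := exists_isFlow (z := (x : ℂ)) D.pos hlam fun s hs => by
      refine hsurv s hs _ (by simp) ?_
      rintro ⟨u, hu, hux⟩
      rcases hu.1.eq_or_lt with rfl | hu0
      · rw [h0, ofReal_inj] at hux
        exact hx.ne hux
      · have := him u ⟨hu0, hu.2.trans_lt hs.2⟩
        rw [hux, ofReal_im] at this
        exact lt_irrefl _ this
    exact ⟨_, hG.isRealFlow hlam hx⟩
  refine ⟨x₀, ?_⟩
  have hlim : Tendsto (fun τ => 5 * (lam T - lam 0) ^ 2 *
      Real.exp (1 / 20 * (Real.log (lam T - lam τ) - Real.log (lam T - lam 0))))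
      (nhdsWithin T (Iio T)) (nhds 0) := by
    have h1 : Tendsto (fun τ => lam T - lam τ) (nhdsWithin T (Iio T))
        (nhdsWithin 0 (Ioi 0)) := by
      refine tendsto_nhdsWithin_iff.2 ⟨?_, ?_⟩
      · simpa using D.tendsto_final.const_sub (lam T)
      · filter_upwards [Ioo_mem_nhdsLT D.pos] with τ hτ
        exact sub_pos.2 (D.lt_final ⟨hτ.1.le, hτ.2⟩)
    have h2 := (Real.tendsto_log_nhdsGT_zero.comp h1)
    have h3 := Real.tendsto_exp_atBot.comp
      ((tendsto_atBot_add_const_right _ (-Real.log (lam T - lam 0)) h2).const_mul_atBot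
        (by norm_num : (0 : ℝ) < 1 / 20))
    simpa [sub_eq_add_neg] using h3.const_mul (5 * (lam T - lam 0) ^ 2)
  rw [Metric.tendsto_nhds]
  intro ε hε
  obtain ⟨τ, hτε, hτ⟩ := ((hlim.eventually_lt_const (show (0 : ℝ) < ε ^ 2 by positivity)).and
    (Ioo_mem_nhdsLT D.pos)).exists
  have hC : T - (T - τ) / (2 * 4 ^ 16) < T := by
    have : 0 < (T - τ) / (2 * 4 ^ 16) := div_pos (sub_pos.2 hτ.2) (by norm_num)
    linarith
  filter_upwards [Ioo_mem_nhdsLT D.pos, Ioo_mem_nhdsLT hC] with t ht ht2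
  have htI : t ∈ Ico 0 T := ⟨ht.1.le, ht.2⟩
  obtain ⟨G, hG⟩ := exists_isFlow (lam := lam) (z := γ t) ht.1
    (hlam.mono (Ico_subset_Ico_right ht.2.le)) fun s hs => by
      refine hsurv s ⟨hs.1, hs.2.trans ht.2⟩ _ (him t ht).le ?_
      rintro ⟨u, hu, hut⟩
      have := hinj ⟨hu.1, (hu.2.trans_lt hs.2).trans ht.2⟩ htI hut
      linarith [hu.2, hs.2]
  have hns : ¬ Survives lam t (γ t) := by
    have : γ t ∈ LoewnerHull lam t := hhull t htI ▸ mem_image_of_mem γ (right_mem_Icc.2 ht.1.le)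
    exact this.2
  have hτt : 2 * 4 ^ 16 * (T - t) < T - τ := by
    have : T - t < (T - τ) / (2 * 4 ^ 16) := by linarith [ht2.1]
    rw [lt_div_iff₀ (by norm_num)] at this
    linarith
  have hfin := (D.norm_sub_sq_le hP h5 hPT hτ.1 ht hτt (him t ht) hG hns).trans_lt hτε
  rw [dist_eq_norm]
  exact lt_of_pow_lt_pow_left₀ 2 hε.le hfin

end CurvedDriver

/-- Reflection in the imaginary axis of surviving points. -/
lemma Survives.neg_conj {lam : ℝ → ℝ} {t : ℝ} {z : ℂ} (h : Survives lam t z) :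
    Survives (fun s => -lam s) t (-(starRingEnd ℂ) z) := by
  obtain ⟨g, hg0, hgc, hg⟩ := h
  refine ⟨fun s => -(starRingEnd ℂ) (g s), by simp only [hg0],
    (continuous_conj.comp_continuousOn hgc).neg, fun s hs => ⟨fun he => (hg s hs).1 ?_, ?_⟩⟩
  · have := congrArg (starRingEnd ℂ) (neg_injective (he.trans (ofReal_neg _)))
    simpa using this
  · have hd := (conjCLE.toContinuousLinearMap.hasFDerivAt.comp_hasDerivWithinAt s
      (hg s hs).2).neg
    refine hd.congr_deriv ?_
    simp only [ContinuousLinearEquiv.coe_coe, conjCLE_apply, map_div₀, map_sub, conj_ofReal,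
      map_ofNat, ofReal_neg]
    rw [← div_neg]
    congr 1
    ring

/-- Reflection in the imaginary axis of a trace. -/
lemma IsSimpleTrace.neg_conj {lam : ℝ → ℝ} {T : ℝ} {γ : ℝ → ℂ} (h : IsSimpleTrace lam T γ) :
    IsSimpleTrace (fun s => -lam s) T (fun t => -(starRingEnd ℂ) (γ t)) := by
  obtain ⟨hc, hinj, h0, him, hhull⟩ := h
  refine ⟨(continuous_conj.comp_continuousOn hc).neg, fun s hs t ht hst => hinj hs ht ?_,
    by simp [h0], fun t ht => by simpa using him t ht, fun t ht => ?_⟩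
  · exact (starRingEnd ℂ).injective (neg_injective hst)
  · have hiff : ∀ z, Survives (fun s => -lam s) t z ↔ Survives lam t (-(starRingEnd ℂ) z) :=
      fun z => ⟨fun hz => by simpa using hz.neg_conj, fun hz => by simpa using hz.neg_conj⟩
    ext z
    have hz : z ∈ LoewnerHull (fun s => -lam s) t ↔ -(starRingEnd ℂ) z ∈ LoewnerHull lam t := by
      simp [LoewnerHull, hiff]
    rw [hz, hhull t ht]
    constructor
    · rintro ⟨u, hu, huz⟩
      exact ⟨u, hu, by simp [huz]⟩
    · rintro ⟨u, hu, rfl⟩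
      exact ⟨u, hu, by simp⟩

/-- Proposition 1.3: under the Loewner curvature hypotheses the
trace has a real limit at the end time. -/
theorem stmt1 (T : ℝ) (hT : 0 < T) (lam d1 d2 : ℝ → ℝ)
    (hcont : ContinuousOn lam (Icc 0 T))
    (hd1 : ∀ t ∈ Ico (0:ℝ) T, HasDerivWithinAt lam (d1 t) (Ico 0 T) t)
    (hd2 : ∀ t ∈ Ico (0:ℝ) T, HasDerivWithinAt d1 (d2 t) (Ico 0 T) t)
    (hd2cont : ContinuousOn d2 (Ico 0 T))
    (hgrow : ∀ t ∈ Ico (0:ℝ) T, 4 * Real.sqrt (T - t) ≤ |lam T - lam t|)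
    (hd1ne : ∀ t ∈ Ico (0:ℝ) T, d1 t ≠ 0)
    (hd2ne : ∀ t ∈ Ico (0:ℝ) T, d2 t ≠ 0)
    (hLC : ∀ t ∈ Ico (0:ℝ) T, 9 ≤ (d1 t) ^ 3 / d2 t)
    (hδ : ∃ δ : ℝ, 0 < δ ∧ ∀ s ∈ Ioo (0:ℝ) T,
      δ * Real.sqrt (T - s) * |d1 s| ≤ sInf ((fun t => (d1 t) ^ 3 / d2 t) '' Ico s T))
    (γ : ℝ → ℂ) (hγ : IsSimpleTrace lam T γ) :
    ∃ L : ℝ, Tendsto γ (nhdsWithin T (Iio T)) (nhds ((L : ℝ) : ℂ)) := by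
  have hd1c : ContinuousOn d1 (Ico 0 T) := fun t ht => (hd2 t ht).continuousWithinAt
  have hcase : (∀ t ∈ Ico (0 : ℝ) T, 0 < d1 t) ∨ ∀ t ∈ Ico (0 : ℝ) T, 0 < -d1 t := by
    by_contra! hcon
    obtain ⟨⟨s, hs, hs0⟩, t, ht, ht0⟩ := hcon
    obtain ⟨u, hu, hu0⟩ := isPreconnected_Ico.intermediate_value hs ht hd1c
      (show (0 : ℝ) ∈ Icc (d1 s) (d1 t) from ⟨hs0, by linarith⟩)
    exact hd1ne u hu hu0
  have hgrowth : ∀ {μ e : ℝ → ℝ}, ContinuousOn μ (Icc 0 T) →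
      (∀ t ∈ Ico (0 : ℝ) T, HasDerivWithinAt μ (e t) (Ico 0 T) t) →
      (∀ t ∈ Ico (0 : ℝ) T, 0 < e t) →
      (∀ t ∈ Ico (0 : ℝ) T, 4 * Real.sqrt (T - t) ≤ |μ T - μ t|) →
      ∀ t ∈ Ico (0 : ℝ) T, 4 * Real.sqrt (T - t) ≤ μ T - μ t := by
    intro μ e hc hd hpos hg t ht
    have hle : μ t ≤ μ T := by
      have hlim : Tendsto μ (nhdsWithin T (Iio T)) (nhds (μ T)) := by
        rw [← nhdsWithin_Ioo_eq_nhdsLT hT]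
        exact (hc T (right_mem_Icc.2 hT.le)).mono Ioo_subset_Icc_self
      refine ge_of_tendsto hlim ?_
      filter_upwards [Ioo_mem_nhdsLT ht.2] with u hu
      have hsub : Icc t u ⊆ Ico 0 T := fun v hv => ⟨ht.1.trans hv.1, hv.2.trans_lt hu.2⟩
      exact le_of_hasDerivWithinAt_nonneg hu.1.le hsub (fun v hv => hd v (hsub hv))
        (fun v hv => (hpos v (hsub hv)).le)
    have h := hg t ht
    rwa [abs_of_nonneg (sub_nonneg.2 hle)] at h
  have hcurv : ∀ {a b : ℝ}, 0 < a → 9 ≤ a ^ 3 / b → 0 ≤ b ∧ 9 * b ≤ a ^ 3 := by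
    intro a b ha h
    have hb : 0 < b := by
      by_contra! hb
      have := div_nonpos_of_nonneg_of_nonpos (pow_pos ha 3).le hb
      linarith
    exact ⟨hb.le, (le_div_iff₀ hb).1 h⟩
  rcases hcase with hpos | hneg
  · have D : CurvedDriver T lam d1 d2 :=
      ⟨hT, hcont, hd1, hd2, hgrowth hcont hd1 hpos hgrow, hpos,
        fun t ht => (hcurv (hpos t ht) (hLC t ht)).1, fun t ht => (hcurv (hpos t ht) (hLC t ht)).2⟩
    exact D.exists_tendsto hγ
  · have hLC' : ∀ t ∈ Ico (0 : ℝ) T, 9 ≤ (-d1 t) ^ 3 / -d2 t := fun t ht => by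
      rw [Odd.neg_pow (by decide), neg_div_neg_eq]
      exact hLC t ht
    have hd1' : ∀ t ∈ Ico (0 : ℝ) T, HasDerivWithinAt (fun s => -lam s) (-d1 t) (Ico 0 T) t :=
      fun t ht => (hd1 t ht).neg
    have D : CurvedDriver T (fun s => -lam s) (fun s => -d1 s) (fun s => -d2 s) :=
      ⟨hT, hcont.neg, hd1', fun t ht => (hd2 t ht).neg,
        hgrowth hcont.neg hd1' hneg fun t ht => by
          simp only [Pi.neg_apply]
          rw [neg_sub_neg, abs_sub_comm]
          exact hgrow t ht,
        hneg, fun t ht => (hcurv (hneg t ht) (hLC' t ht)).1,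
        fun t ht => (hcurv (hneg t ht) (hLC' t ht)).2⟩
    obtain ⟨L, hL⟩ := D.exists_tendsto hγ.neg_conj
    refine ⟨-L, ?_⟩
    have h := ((continuous_conj.tendsto _).comp hL).neg
    simpa using h
end
end

section
/- Let k ≥ 4 and let λ(t) = k√(1−t) for t ∈ [0,1]. Then the Loewner hull K₁ at time 1 driven by λ contains every real point of the interval [(k − √(k²−16))/2, k]; that is, for every real x with (k − √(k²−16))/2 ≤ x ≤ k, there is no continuous g : [0,1] → ℂ with g(0) = x, g(s) ≠ λ(s) for all s ∈ [0,1], and g'(s) = 2/(g(s) − λ(s)) on [0,1]. -/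
open Set Complex Filter

noncomputable section

/-- A Loewner flow line started at a real point stays real. -/
theorem Survives.exists_real {lam : ℝ → ℝ} {t x : ℝ} (h : Survives lam t (x : ℂ)) :
    ∃ u : ℝ → ℝ, u 0 = x ∧ ContinuousOn u (Icc 0 t) ∧
      ∀ s ∈ Icc (0:ℝ) t, u s ≠ lam s ∧
        HasDerivWithinAt u (2 / (u s - lam s)) (Icc 0 t) s := by
  obtain ⟨g, hg0, hgc, hg⟩ := h
  have him_cont : ContinuousOn (fun s => (g s).im) (Icc 0 t) :=
    Complex.continuous_im.comp_continuousOn hgc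
  have him_sq : ∀ ⦃s⦄, s ∈ Icc 0 t → (g s).im ^ 2 ≤ 0 := by
    refine image_le_of_deriv_right_le_deriv_boundary
      (f' := fun s => 2 * (g s).im * (2 / (g s - (lam s : ℂ))).im)
      (B := fun _ => 0) (B' := fun _ => 0) (him_cont.pow 2) (fun s hs => ?_)
      (by simp [hg0]) continuousOn_const (fun s _ => hasDerivWithinAt_const ..)
      (fun s _ => ?_)
    · have hd : HasDerivWithinAt (fun s => (g s).im) _ _ s :=
        Complex.imCLM.hasFDerivAt.comp_hasDerivWithinAt s (hg s (Ico_subset_Icc_self hs)).2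
      simpa using (hd.mono_of_mem_nhdsWithin (Icc_mem_nhdsGE_of_mem hs)).pow 2
    · have : 2 * (g s).im * (2 / (g s - (lam s : ℂ))).im =
          -(4 * ((g s).im ^ 2 / normSq (g s - (lam s : ℂ)))) := by
        simp [Complex.div_im]
        ring
      rw [this]
      have := Complex.normSq_nonneg (g s - (lam s : ℂ))
      have : 0 ≤ (g s).im ^ 2 / normSq (g s - (lam s : ℂ)) := by positivity
      linarith
  have hreal : ∀ s ∈ Icc 0 t, g s = ((g s).re : ℂ) := fun s hs =>
    Complex.ext rfl (by simpa using le_antisymm (him_sq hs) (sq_nonneg _))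
  refine ⟨fun s => (g s).re, by simp [hg0],
    Complex.continuous_re.comp_continuousOn hgc, fun s hs => ⟨fun heq => ?_, ?_⟩⟩
  · exact (hg s hs).1 ((hreal s hs).trans (congrArg _ heq))
  · have hd := Complex.reCLM.hasFDerivAt.comp_hasDerivWithinAt s (hg s hs).2
    have hval : (2 / (g s - (lam s : ℂ))).re = 2 / ((g s).re - lam s) := by
      rw [hreal s hs]
      norm_cast
    rw [← hval]
    exact hd

/-- A nonvanishing continuous real function on `[0, t]` that starts below `0` stays below `0`. -/
theorem neg_of_continuousOn_ne_zero {f : ℝ → ℝ} {t : ℝ} (hf : ContinuousOn f (Icc 0 t))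
    (h0 : f 0 < 0) (hne : ∀ s ∈ Icc 0 t, f s ≠ 0) : ∀ s ∈ Icc 0 t, f s < 0 := by
  intro s hs
  by_contra! hpos
  obtain ⟨r, hr, hr0⟩ := intermediate_value_Icc hs.1
    (hf.mono (Icc_subset_Icc_right hs.2)) ⟨h0.le, hpos⟩
  exact hne r ⟨hr.1, hr.2.trans hs.2⟩ hr0

/-- If `a (k - a) = 4` with `a < k`, no real flow line started in `[a, k]` survives to time `1`
under the driving function `k √(1 - t)`: it is trapped above the solution `a √(1 - t)`. -/
theorem not_survives_sqrt {k a x : ℝ} (hak : a < k) (hroot : a * (k - a) = 4)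
    (hax : a ≤ x) (hxk : x ≤ k) :
    ¬ Survives (fun t => k * Real.sqrt (1 - t)) 1 (x : ℂ) := by
  intro h
  obtain ⟨u, hu0, huc, hu⟩ := h.exists_real
  have hsqrt : Continuous fun s : ℝ => Real.sqrt (1 - s) := by fun_prop
  have hlt : ∀ s ∈ Icc (0:ℝ) 1, u s - k * Real.sqrt (1 - s) < 0 := by
    refine neg_of_continuousOn_ne_zero (huc.sub (hsqrt.const_smul k).continuousOn) ?_
      fun s hs => sub_ne_zero.2 (hu s hs).1
    have h0 := (hu 0 (by simp)).1
    simp only [hu0, sub_zero, Real.sqrt_one, mul_one] at h0 ⊢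
    exact sub_neg.2 (lt_of_le_of_ne hxk h0)
  have hbound : ∀ ε > 0, a * Real.sqrt (1 - 1) - u 1 ≤ ε * (1 + 1) := by
    intro ε hε
    refine image_le_of_deriv_right_lt_deriv_boundary
      (f := fun s => a * Real.sqrt (1 - s) - u s)
      (f' := fun s => a * (-1 / (2 * Real.sqrt (1 - s))) - 2 / (u s - k * Real.sqrt (1 - s)))
      (B := fun s => ε * (1 + s)) (B' := fun _ => ε)
      ((hsqrt.const_smul a).continuousOn.sub huc) (fun s hs => ?_) ?_ (fun s => ?_)
      (fun s hs heq => ?_) (right_mem_Icc.2 zero_le_one)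
    · refine HasDerivWithinAt.sub ?_ ((hu s (Ico_subset_Icc_self hs)).2.mono_of_mem_nhdsWithin
        (Icc_mem_nhdsGE_of_mem hs))
      exact ((((hasDerivAt_id s).const_sub 1).sqrt
        (sub_pos.2 hs.2).ne').const_mul a).hasDerivWithinAt
    · simp only [sub_zero, Real.sqrt_one, hu0]
      linarith
    · simpa using ((hasDerivAt_id s).const_add 1).const_mul ε
    · have hr : 0 < Real.sqrt (1 - s) := Real.sqrt_pos.2 (sub_pos.2 hs.2)
      have hl := hlt s (Ico_subset_Icc_self hs)
      set r := Real.sqrt (1 - s)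
      have hpos : 0 < a * r - u s := by
        have := hs.1
        have : 0 < ε * (1 + s) := by positivity
        linarith
      have hp : a * (-1 / (2 * r)) = -(2 / ((k - a) * r)) := by
        have := (sub_pos.2 hak).ne'
        field_simp
        linarith
      have hle : 2 / (k * r - u s) ≤ 2 / ((k - a) * r) := by
        have : 0 < (k - a) * r := mul_pos (sub_pos.2 hak) hr
        gcongr
        linarith
      have hneg : 2 / (u s - k * r) = -(2 / (k * r - u s)) := by
        rw [← div_neg, neg_sub]
      rw [hp, hneg]
      linarith
  have h1 := hlt 1 (by simp)
  simp only [sub_self, Real.sqrt_zero, mul_zero, sub_zero, zero_sub] at h1 hbound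
  have := hbound (-u 1 / 4) (by linarith)
  linarith

/-- first part of Lemma 2.1: the hull at time 1 driven by
`k√(1-t)` with `k ≥ 4` contains the real interval `[(k-√(k²-16))/2, k]`. -/
theorem stmt3 (k : ℝ) (hk : 4 ≤ k) (x : ℝ)
    (hx : (k - Real.sqrt (k ^ 2 - 16)) / 2 ≤ x) (hx' : x ≤ k) :
    ((x : ℝ) : ℂ) ∈ LoewnerHull (fun t => k * Real.sqrt (1 - t)) 1 ∧
      ¬ Survives (fun t => k * Real.sqrt (1 - t)) 1 ((x : ℝ) : ℂ) := by
  have hsq : Real.sqrt (k ^ 2 - 16) ^ 2 = k ^ 2 - 16 := Real.sq_sqrt (by nlinarith)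
  have hnn := Real.sqrt_nonneg (k ^ 2 - 16)
  have hns : ¬ Survives (fun t => k * Real.sqrt (1 - t)) 1 (x : ℂ) :=
    not_survives_sqrt (a := (k - Real.sqrt (k ^ 2 - 16)) / 2)
      (by linarith) (by linarith) hx hx'
  exact ⟨⟨by simp, hns⟩, hns⟩
end
end

section
/- Let k ≥ 4 and let λ : [0,1] → ℝ be a continuous driving function with λ(1) = 0 and λ(t) ≥ k√(1−t) for all t ∈ [0,1]. Then the Loewner hull K₁ at time 1 driven by λ contains the real interval [(k − √(k²−16))/2, λ(0)]; that is, every real x with (k − √(k²−16))/2 ≤ x ≤ λ(0) does not survive to time 1. -/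
open Set Complex Filter

noncomputable section

/-- A continuous function on `[a, b]` that is nonnegative at `a` and has nonnegative derivative
wherever it is negative is nonnegative at `b`. -/
theorem nonneg_right_of_deriv_nonneg_of_neg {a b : ℝ} {d d' : ℝ → ℝ} (hab : a ≤ b)
    (hd : ContinuousOn d (Icc a b)) (ha : 0 ≤ d a)
    (hderiv : ∀ t ∈ Ioo a b, HasDerivAt d (d' t) t)
    (hnonneg : ∀ t ∈ Ioo a b, d t < 0 → 0 ≤ d' t) : 0 ≤ d b := by
  have hclosed : IsClosed (Icc a b ∩ d ⁻¹' Ici 0) :=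
    hd.preimage_isClosed_of_isClosed isClosed_Icc isClosed_Ici
  have hcompact : IsCompact (Icc a b ∩ d ⁻¹' Ici 0) :=
    isCompact_Icc.of_isClosed_subset hclosed inter_subset_left
  obtain ⟨s, ⟨hs, hds⟩, hmax⟩ := hcompact.exists_isGreatest ⟨a, ⟨le_rfl, hab⟩, ha⟩
  have hmono : MonotoneOn d (Icc s b) := by
    refine monotoneOn_of_deriv_nonneg (convex_Icc s b)
      (hd.mono (Icc_subset_Icc_left hs.1)) ?_ ?_ <;> rw [interior_Icc] <;> intro t ht
    · exact (hderiv t ⟨hs.1.trans_lt ht.1, ht.2⟩).differentiableAt.differentiableWithinAt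
    · have ht' : t ∈ Ioo a b := ⟨hs.1.trans_lt ht.1, ht.2⟩
      rw [(hderiv t ht').deriv]
      refine hnonneg t ht' (lt_of_not_ge fun h => ?_)
      exact (hmax ⟨Ioo_subset_Icc_self ht', h⟩).not_gt ht.1
  exact le_trans hds (hmono ⟨le_rfl, hs.2⟩ ⟨hs.2, le_rfl⟩ hs.2)

/-- A solution of the Loewner equation started on the real line stays real. -/
theorem im_eq_zero_of_loewner {lam : ℝ → ℝ} {T : ℝ} {g : ℝ → ℂ} (h0 : (g 0).im = 0)
    (hg : ContinuousOn g (Icc 0 T))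
    (hderiv : ∀ s ∈ Icc (0:ℝ) T,
      HasDerivWithinAt g (2 / (g s - (lam s : ℂ))) (Icc 0 T) s) :
    ∀ s ∈ Icc (0:ℝ) T, (g s).im = 0 := by
  have hder : ∀ t ∈ Ioo (0:ℝ) T, HasDerivAt (fun u => (g u).im ^ 2)
      (2 * (g t).im * (2 / (g t - (lam t : ℂ))).im) t := by
    intro t ht
    have h := (hderiv t (Ioo_subset_Icc_self ht)).hasDerivAt (Icc_mem_nhds ht.1 ht.2)
    have h' : HasDerivAt (fun u => (g u).im) (2 / (g t - (lam t : ℂ))).im t :=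
      imCLM.hasFDerivAt.comp_hasDerivAt t h
    have h2 := h'.pow 2
    simp only [Nat.cast_ofNat, Nat.add_one_sub_one, pow_one] at h2
    exact h2
  have hanti : AntitoneOn (fun u => (g u).im ^ 2) (Icc 0 T) := by
    refine antitoneOn_of_deriv_nonpos (convex_Icc 0 T)
      ((continuous_im.comp_continuousOn hg).pow 2) ?_ ?_ <;> rw [interior_Icc] <;> intro t ht
    · exact (hder t ht).differentiableAt.differentiableWithinAt
    · rw [(hder t ht).deriv]
      have him : (2 / (g t - (lam t : ℂ))).im
          = -(2 * (g t).im / normSq (g t - (lam t : ℂ))) := by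
        simp [div_im]
      have : 0 ≤ (2 * (g t).im) ^ 2 / normSq (g t - (lam t : ℂ)) :=
        div_nonneg (sq_nonneg _) (normSq_nonneg _)
      rw [him]
      calc _ = -((2 * (g t).im) ^ 2 / normSq (g t - (lam t : ℂ))) := by ring
        _ ≤ 0 := neg_nonpos.2 this
  intro s hs
  have h := hanti ⟨le_rfl, hs.1.trans hs.2⟩ hs hs.1
  simp only [h0] at h
  nlinarith [sq_nonneg (g s).im]

/-- second part of Lemma 2.1: if `lam(1) = 0` and
`lam(t) ≥ k√(1-t)` with `k ≥ 4`, the hull at time 1 contains the real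
interval `[(k-√(k²-16))/2, lam 0]`. -/
theorem stmt4 (k : ℝ) (hk : 4 ≤ k) (lam : ℝ → ℝ)
    (hcont : ContinuousOn lam (Icc 0 1)) (h1 : lam 1 = 0)
    (hlow : ∀ t ∈ Icc (0:ℝ) 1, k * Real.sqrt (1 - t) ≤ lam t)
    (x : ℝ) (hx : (k - Real.sqrt (k ^ 2 - 16)) / 2 ≤ x) (hx' : x ≤ lam 0) :
    ((x : ℝ) : ℂ) ∈ LoewnerHull lam 1 ∧ ¬ Survives lam 1 ((x : ℝ) : ℂ) := by
  suffices h : ¬ Survives lam 1 (x : ℂ) from ⟨⟨by simp, h⟩, h⟩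
  rintro ⟨g, hg0, hgc, hg⟩
  have him := im_eq_zero_of_loewner (by simp [hg0]) hgc fun s hs => (hg s hs).2
  have hreal : ∀ s ∈ Icc (0:ℝ) 1, g s = ((g s).re : ℂ) := fun s hs =>
    Complex.ext (by simp) (by simp [him s hs])
  have hrec : ContinuousOn (fun s => (g s).re) (Icc 0 1) :=
    continuous_re.comp_continuousOn hgc
  have hne : ∀ s ∈ Icc (0:ℝ) 1, (g s).re ≠ lam s := fun s hs h =>
    (hg s hs).1 (by rw [hreal s hs, h])
  have hlt : ∀ s ∈ Icc (0:ℝ) 1, (g s).re < lam s := by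
    intro s hs
    by_contra! hle
    obtain ⟨t, ht, hteq⟩ := isPreconnected_Icc.intermediate_value₂
      (left_mem_Icc.2 zero_le_one) hs hrec hcont (by simpa [hg0] using hx') hle
    exact hne t ht hteq
  set a := (k - Real.sqrt (k ^ 2 - 16)) / 2 with ha
  have hsq : Real.sqrt (k ^ 2 - 16) ^ 2 = k ^ 2 - 16 := Real.sq_sqrt (by nlinarith)
  have hmul : a * (k - a) = 4 := by rw [ha]; linarith
  have hak : 0 < k - a := by
    rw [ha]
    linarith [Real.sqrt_nonneg (k ^ 2 - 16)]
  have hdiv : 2 / (k - a) = a / 2 := by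
    rw [div_eq_div_iff hak.ne' two_ne_zero]
    linarith
  have hderiv : ∀ t ∈ Ioo (0:ℝ) 1, HasDerivAt (fun s => (g s).re - a * Real.sqrt (1 - s))
      (2 / ((g t).re - lam t) - a * (-1 / (2 * Real.sqrt (1 - t)))) t := by
    intro t ht
    have ht' := Ioo_subset_Icc_self ht
    have h := (hg t ht').2.hasDerivAt (Icc_mem_nhds ht.1 ht.2)
    have hre : HasDerivAt (fun s => (g s).re) (2 / (g t - (lam t : ℂ))).re t :=
      reCLM.hasFDerivAt.comp_hasDerivAt t h
    have hval : (2 / (g t - (lam t : ℂ))).re = 2 / ((g t).re - lam t) := by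
      rw [hreal t ht', ofReal_re]
      exact_mod_cast ofReal_re (2 / ((g t).re - lam t))
    rw [hval] at hre
    have hne' : (1:ℝ) - id t ≠ 0 := (sub_pos.2 ht.2).ne'
    exact hre.sub ((((hasDerivAt_id t).const_sub 1).sqrt hne').const_mul a)
  have hend := nonneg_right_of_deriv_nonneg_of_neg zero_le_one
    (d := fun s => (g s).re - a * Real.sqrt (1 - s))
    (hrec.sub (by fun_prop)) (by simpa [hg0] using hx) hderiv ?_
  · have := hlt 1 (right_mem_Icc.2 zero_le_one)
    simp only [sub_self, Real.sqrt_zero, mul_zero, sub_zero] at hend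
    linarith
  · intro t ht hneg
    have ht' := Ioo_subset_Icc_self ht
    have hτ : 0 < Real.sqrt (1 - t) := Real.sqrt_pos.2 (by linarith [ht.2])
    have hgap : (k - a) * Real.sqrt (1 - t) ≤ lam t - (g t).re := by
      linarith [hlow t ht']
    have hle : 2 / (lam t - (g t).re) ≤ a / 2 / Real.sqrt (1 - t) := by
      rw [← hdiv, div_div]
      gcongr
    have h2 : 2 / ((g t).re - lam t) = -(2 / (lam t - (g t).re)) := by
      rw [← neg_sub, div_neg]
    rw [h2]
    calc 0 ≤ a / 2 / Real.sqrt (1 - t) - 2 / (lam t - (g t).re) := sub_nonneg.2 hle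
      _ = _ := by ring
end
end

section
/- Let k > 0 and let λ : [0,1] → ℝ be a continuous driving function with λ(1) = 0 and λ(t) ≥ k√(1−t) for all t ∈ [0,1]. Then the Loewner hull K₁ at time 1 driven by λ satisfies K₁ ∩ ( (−∞, 2] × [26/k, ∞) ) = ∅; that is, every z with Im z ≥ 0, Re z ≤ 2 and Im z ≥ 26/k survives to time 1. -/
open Set Complex Filter

noncomputable section

/-- Raise the imaginary part of `w` to at least `ε`. -/
def raiseIm (ε : ℝ) (w : ℂ) : ℂ := ⟨w.re, max w.im ε⟩

lemma norm_raiseIm_sub_le (ε : ℝ) (w v : ℂ) : ‖raiseIm ε w - raiseIm ε v‖ ≤ ‖w - v‖ := by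
  rw [Complex.norm_eq_sqrt_sq_add_sq, Complex.norm_eq_sqrt_sq_add_sq]
  apply Real.sqrt_le_sqrt
  have h := sq_le_sq.mpr (abs_max_sub_max_le_abs w.im v.im ε)
  simpa [raiseIm] using h

lemma le_norm_raiseIm_sub_ofReal (ε : ℝ) (w : ℂ) (x : ℝ) :
    ε ≤ ‖raiseIm ε w - x‖ := by
  have h := Complex.abs_im_le_norm (raiseIm ε w - x)
  have h2 : (raiseIm ε w - x).im = max w.im ε := by simp [raiseIm]
  rw [h2] at h
  exact (le_max_right _ _).trans ((le_abs_self _).trans h)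

/-- The Loewner equation with the imaginary part truncated from below has global solutions. -/
lemma exists_truncated_solution {ε : ℝ} (hε : 0 < ε) {lam : ℝ → ℝ}
    (hcont : ContinuousOn lam (Icc 0 1)) (z : ℂ) :
    ∃ g : ℝ → ℂ, g 0 = z ∧ ∀ s ∈ Icc (0:ℝ) 1,
      HasDerivWithinAt g (2 / (raiseIm ε (g s) - (lam s : ℂ))) (Icc 0 1) s := by
  have hne (w : ℂ) (x : ℝ) : raiseIm ε w - x ≠ 0 :=
    norm_pos_iff.mp (hε.trans_le (le_norm_raiseIm_sub_ofReal ε w x))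
  have hPL : IsPicardLindelof (fun t w ↦ 2 / (raiseIm ε w - (lam t : ℂ)))
      (⟨0, by simp⟩ : Icc (0:ℝ) 1) z (2 / ε).toNNReal 0 (2 / ε).toNNReal
      (2 / ε ^ 2).toNNReal := by
    refine ⟨fun t _ ↦ LipschitzOnWith.of_dist_le_mul fun w _ v _ ↦ ?_, fun w _ ↦ ?_,
      fun t _ w _ ↦ ?_, ?_⟩
    · rw [dist_eq_norm, dist_eq_norm, Real.coe_toNNReal _ (by positivity),
        div_sub_div _ _ (hne _ _) (hne _ _), norm_div, norm_mul]
      have hnum : (2 * (raiseIm ε v - (lam t : ℂ)) - (raiseIm ε w - (lam t : ℂ)) * 2)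
          = 2 * (raiseIm ε v - raiseIm ε w) := by ring
      rw [hnum, norm_mul, Complex.norm_ofNat, div_mul_eq_mul_div]
      have h1 := norm_raiseIm_sub_le ε v w
      rw [norm_sub_rev v w] at h1
      have h2 := le_norm_raiseIm_sub_ofReal ε w (lam t)
      have h3 := le_norm_raiseIm_sub_ofReal ε v (lam t)
      rw [sq]
      gcongr
    · refine ContinuousOn.div continuousOn_const ?_ fun t _ ↦ hne _ _
      exact continuousOn_const.sub (Complex.continuous_ofReal.comp_continuousOn hcont)
    · rw [Real.coe_toNNReal _ (by positivity), norm_div, Complex.norm_ofNat]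
      gcongr
      exact le_norm_raiseIm_sub_ofReal ε w (lam t)
    · simp
  exact hPL.exists_eq_forall_mem_Icc_hasDerivWithinAt₀

lemma sub_le_mul_of_hasDerivWithinAt_le {f f' : ℝ → ℝ} {a b C : ℝ}
    (hf : ∀ s ∈ Icc a b, HasDerivWithinAt f (f' s) (Icc a b) s)
    (hC : ∀ s ∈ Ico a b, f' s ≤ C) {t : ℝ} (ht : t ∈ Icc a b) :
    f t ≤ f a + C * (t - a) := by
  have hB (s : ℝ) : HasDerivAt (fun s ↦ f a + C * (s - a)) C s := by
    simpa using (((hasDerivAt_id s).sub_const a).const_mul C).const_add (f a)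
  exact image_le_of_deriv_right_le_deriv_boundary (fun s hs ↦ (hf s hs).continuousWithinAt)
    (fun s hs ↦ (hf s (Ico_subset_Icc_self hs)).mono_of_mem_nhdsWithin
      (Icc_mem_nhdsGE_of_mem hs))
    (by simp) (fun s _ ↦ (hB s).continuousAt.continuousWithinAt)
    (fun s _ ↦ (hB s).hasDerivWithinAt) hC ht

/-- A point starting with real part at most `2` never moves past real part `2` as long as
the driving function is at least `6`. -/
lemma re_le_of_truncated {ε t₁ : ℝ} (hε : 0 < ε) {lam x Y : ℝ → ℝ}
    (hY : ∀ s ∈ Icc 0 t₁, ε ≤ Y s) (hlam : ∀ s ∈ Ico 0 t₁, 6 ≤ lam s) (hx0 : x 0 ≤ 2)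
    (hx : ∀ s ∈ Icc 0 t₁, HasDerivWithinAt x
      (2 * (x s - lam s) / ((x s - lam s) ^ 2 + Y s ^ 2)) (Icc 0 t₁) s) :
    ∀ s ∈ Icc 0 t₁, x s ≤ 2 := by
  intro s hs
  refine image_le_of_deriv_right_lt_deriv_boundary (B := fun _ ↦ 2) (B' := fun _ ↦ 0)
    (fun s hs ↦ (hx s hs).continuousWithinAt)
    (fun s hs ↦ (hx s (Ico_subset_Icc_self hs)).mono_of_mem_nhdsWithin
      (Icc_mem_nhdsGE_of_mem hs)) hx0 (fun s ↦ hasDerivAt_const s 2) (fun s hs h ↦ ?_) hs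
  have h1 := hlam s hs
  have h2 := hY s (Ico_subset_Icc_self hs)
  have h3 : 0 < Y s := hε.trans_le h2
  exact div_neg_of_neg_of_pos (by linarith) (by positivity)

lemma survives_of_sqrt_le {k : ℝ} (hk : 0 < k) {lam : ℝ → ℝ}
    (hcont : ContinuousOn lam (Icc 0 1))
    (hlow : ∀ t ∈ Icc (0:ℝ) 1, k * Real.sqrt (1 - t) ≤ lam t) {z : ℂ}
    (hre : z.re ≤ 2) (him : 26 / k ≤ z.im) : Survives lam 1 z := by
  set ε : ℝ := 12 / k with hεdef
  have hε : 0 < ε := by positivity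
  obtain ⟨g, hg0, hg⟩ := exists_truncated_solution hε hcont z
  set x : ℝ → ℝ := fun s ↦ (g s).re with hxdef
  set y : ℝ → ℝ := fun s ↦ (g s).im with hydef
  set Y : ℝ → ℝ := fun s ↦ max (y s) ε with hYdef
  have hYε (s : ℝ) : ε ≤ Y s := le_max_right _ _
  have hYpos (s : ℝ) : 0 < Y s := hε.trans_le (hYε s)
  have hx (s : ℝ) (hs : s ∈ Icc (0:ℝ) 1) : HasDerivWithinAt x
      (2 * (x s - lam s) / ((x s - lam s) ^ 2 + Y s ^ 2)) (Icc 0 1) s := by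
    refine (Complex.reCLM.hasFDerivAt.comp_hasDerivWithinAt s (hg s hs)).congr_deriv ?_
    simp [Complex.div_re, Complex.normSq_apply, raiseIm, hYdef, hxdef, hydef, sq]
  have hy (s : ℝ) (hs : s ∈ Icc (0:ℝ) 1) : HasDerivWithinAt y
      (-(2 * Y s / ((x s - lam s) ^ 2 + Y s ^ 2))) (Icc 0 1) s := by
    refine (Complex.imCLM.hasFDerivAt.comp_hasDerivWithinAt s (hg s hs)).congr_deriv ?_
    simp [Complex.div_im, Complex.normSq_apply, raiseIm, hYdef, hxdef, hydef, sq]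
  set t₁ : ℝ := max 0 (1 - 36 / k ^ 2) with ht₁def
  have ht₁0 : 0 ≤ t₁ := le_max_left _ _
  have ht₁1 : t₁ ≤ 1 := max_le zero_le_one (sub_le_self _ (by positivity))
  have hsub : Icc 0 t₁ ⊆ Icc (0:ℝ) 1 := Icc_subset_Icc_right ht₁1
  have hsub' : Icc t₁ 1 ⊆ Icc (0:ℝ) 1 := Icc_subset_Icc_left ht₁0
  have hlam (s : ℝ) (hs : s ∈ Ico 0 t₁) : 6 ≤ lam s := by
    have h1 : s < 1 - 36 / k ^ 2 := by
      rcases lt_max_iff.mp hs.2 with h | h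
      · exact absurd hs.1 (not_le.mpr h)
      · exact h
    refine le_trans ?_ (hlow s (hsub (Ico_subset_Icc_self hs)))
    rw [← div_le_iff₀' hk]
    apply Real.le_sqrt_of_sq_le
    rw [div_pow]
    linarith
  have hx2 := re_le_of_truncated hε (fun s _ ↦ hYε s) hlam (by simpa [hxdef, hg0] using hre)
    (fun s hs ↦ (hx s (hsub hs)).mono hsub)
  have hy0 : y 0 = z.im := by simp [hydef, hg0]
  have hε0 : ε ≤ y 0 := by
    rw [hy0]
    refine le_trans ?_ him
    rw [hεdef]
    gcongr
    norm_num
  have hydec (s : ℝ) (hs : s ∈ Icc (0:ℝ) 1) : y s ≤ y 0 := by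
    have h := sub_le_mul_of_hasDerivWithinAt_le (C := 0) hy (fun s _ ↦ by
      have := hYpos s
      rw [neg_nonpos]
      positivity) hs
    simpa using h
  have phase1 (t : ℝ) (ht : t ∈ Icc 0 t₁) : y 0 * (7 / 8) ≤ y t := by
    have h := sub_le_mul_of_hasDerivWithinAt_le (C := y 0 / 8)
      (fun s hs ↦ ((hy s (hsub hs)).mono hsub).neg) (fun s hs ↦ by
        have h1 := hlam s hs
        have h2 := hx2 s (Ico_subset_Icc_self hs)
        have h3 : Y s ≤ y 0 := max_le (hydec s (hsub (Ico_subset_Icc_self hs))) hε0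
        have h4 := hYpos s
        have h5 : 16 ≤ (x s - lam s) ^ 2 + Y s ^ 2 := by nlinarith
        rw [neg_neg, div_le_iff₀ (by linarith)]
        nlinarith) ht
    simp only [Pi.neg_apply] at h
    have h6 := (hsub ht).2
    nlinarith
  have phase2 (t : ℝ) (ht : t ∈ Icc t₁ 1) : y t₁ - 6 / k ≤ y t := by
    have h := sub_le_mul_of_hasDerivWithinAt_le (C := k / 6)
      (fun s hs ↦ ((hy s (hsub' hs)).mono hsub').neg) (fun s hs ↦ by
        have h4 := hYpos s
        have h5 : 12 ≤ k * Y s := by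
          have := hYε s
          rwa [hεdef, div_le_iff₀' hk] at this
        rw [neg_neg, div_le_iff₀ (by positivity)]
        nlinarith [mul_nonneg hk.le (sq_nonneg (x s - lam s))]) ht
    simp only [Pi.neg_apply] at h
    have h6 : t - t₁ ≤ 36 / k ^ 2 := by
      have := ht.2
      have := le_max_right 0 (1 - 36 / k ^ 2)
      linarith
    have h7 : k / 6 * (t - t₁) ≤ k / 6 * (36 / k ^ 2) := by gcongr
    have h8 : k / 6 * (36 / k ^ 2) = 6 / k := by
      field_simp
      norm_num
    linarith
  have hyε (t : ℝ) (ht : t ∈ Icc (0:ℝ) 1) : ε ≤ y t := by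
    have e1 : 26 / k = 26 * (1 / k) := by ring
    have e2 : 6 / k = 6 * (1 / k) := by ring
    have e3 : ε = 12 * (1 / k) := by rw [hεdef]; ring
    have h0 : 0 < 1 / k := by positivity
    have h1 := phase1 t₁ ⟨ht₁0, le_rfl⟩
    rcases le_total t t₁ with h | h
    · have := phase1 t ⟨ht.1, h⟩
      linarith
    · have := phase2 t ⟨h, ht.2⟩
      linarith
  refine ⟨g, hg0, fun s hs ↦ (hg s hs).continuousWithinAt, fun s hs ↦ ⟨fun h ↦ ?_, ?_⟩⟩
  · have h1 := hyε s hs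
    simp only [hydef, h, Complex.ofReal_im] at h1
    linarith
  · have h1 : raiseIm ε (g s) = g s := Complex.ext rfl (max_eq_left (hyε s hs))
    simpa [h1] using hg s hs

/-- Lemma 3.2: if `lam(1) = 0` and `lam(t) ≥ k√(1-t)`, then
`K₁ ∩ ((-∞,2] × [26/k,∞)) = ∅`. -/
theorem stmt5 (k : ℝ) (hk : 0 < k) (lam : ℝ → ℝ)
    (hcont : ContinuousOn lam (Icc 0 1)) (h1 : lam 1 = 0)
    (hlow : ∀ t ∈ Icc (0:ℝ) 1, k * Real.sqrt (1 - t) ≤ lam t) :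
    (LoewnerHull lam 1 ∩ {z : ℂ | z.re ≤ 2 ∧ 26 / k ≤ z.im} = ∅) ∧
      ∀ z : ℂ, 0 ≤ z.im → z.re ≤ 2 → 26 / k ≤ z.im → Survives lam 1 z := by
  have key : ∀ z : ℂ, 0 ≤ z.im → z.re ≤ 2 → 26 / k ≤ z.im → Survives lam 1 z := by
    intro z _ hre him
    exact survives_of_sqrt_le hk hcont hlow hre him
  refine ⟨?_, key⟩
  ext z
  simp only [LoewnerHull, mem_inter_iff, mem_ofPred_eq, mem_empty_iff_false, iff_false]
  rintro ⟨⟨h0, hs⟩, hre, him⟩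
  exact hs (key z h0 hre him)
end
end

section
/- Let a ≥ 4, r ∈ (0, 1/2), and let λ : [0,1] → ℝ be continuous with λ(1) = 0 and λ(t) ≥ a(1−t)^r for all t ∈ [0,1]. Fix s ∈ [0,1) and let K̂ denote the Loewner hull at time 1−s driven by the shifted driving function μ_s : [0,1−s] → ℝ, μ_s(t) = λ(s+t). Then K̂ ∩ ( (−∞, 2√(1−s)] × [26·a^{−1}(1−s)^{1−r}, ∞) ) = ∅; that is, every z with Im z ≥ 0, Re z ≤ 2√(1−s) and Im z ≥ 26·a^{−1}·(1−s)^{1−r} survives to time 1−s for the driver μ_s. -/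
open Set Complex Filter

noncomputable section

/-- Raise the imaginary part of `w` to at least `c`. -/
def imClip (c : ℝ) (w : ℂ) : ℂ := ⟨w.re, max w.im c⟩

lemma norm_imClip_sub_le (c : ℝ) (w w' : ℂ) : ‖imClip c w - imClip c w'‖ ≤ ‖w - w'‖ := by
  refine (sq_le_sq₀ (norm_nonneg _) (norm_nonneg _)).1 ?_
  have h := sq_le_sq.2 ((abs_max_sub_max_le_abs w.im w'.im c).trans_eq (abs_abs _).symm)
  rw [sq_abs] at h
  simp only [Complex.sq_norm, normSq_apply, imClip, sub_re, sub_im]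
  nlinarith

lemma le_norm_imClip_sub (c : ℝ) (w : ℂ) (x : ℝ) : c ≤ ‖imClip c w - x‖ := by
  refine le_trans ?_ (abs_im_le_norm _)
  refine le_trans ?_ (le_abs_self _)
  simp [imClip]

/-- The chordal Loewner equation with the imaginary part clipped from below has global
solutions. -/
lemma exists_clipped_solution {mu : ℝ → ℝ} {T c : ℝ} (hT : 0 ≤ T) (hc : 0 < c)
    (hmu : ContinuousOn mu (Icc 0 T)) (z : ℂ) :
    ∃ g : ℝ → ℂ, g 0 = z ∧ ∀ t ∈ Icc 0 T,
      HasDerivWithinAt g (2 / (imClip c (g t) - (mu t : ℂ))) (Icc 0 T) t := by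
  have hne (w : ℂ) (x : ℝ) : imClip c w - (x : ℂ) ≠ 0 :=
    norm_pos_iff.1 (hc.trans_le (le_norm_imClip_sub c w x))
  have hpl : IsPicardLindelof (fun t w => 2 / (imClip c w - (mu t : ℂ)))
      (⟨0, le_rfl, hT⟩ : Icc (0 : ℝ) T) z (Real.toNNReal (2 / c * T)) 0
      (Real.toNNReal (2 / c)) (Real.toNNReal (2 / c ^ 2)) := by
    refine ⟨fun t _ => ?_, fun w _ => ?_, fun t _ w _ => ?_, ?_⟩
    · refine LipschitzWith.lipschitzOnWith (LipschitzWith.of_dist_le_mul fun w w' => ?_)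
      rw [dist_eq_norm, dist_eq_norm, Real.coe_toNNReal _ (by positivity),
        div_sub_div _ _ (hne w _) (hne w' _), norm_div, norm_mul,
        show 2 * (imClip c w' - (mu t : ℂ)) - (imClip c w - (mu t : ℂ)) * 2 =
          2 * (imClip c w' - imClip c w) by ring, norm_mul, Complex.norm_ofNat, sq,
        div_mul_eq_mul_div, norm_sub_rev]
      exact div_le_div₀ (by positivity)
        (mul_le_mul_of_nonneg_left (norm_imClip_sub_le c w w') zero_le_two) (by positivity)
        (mul_le_mul (le_norm_imClip_sub c w _) (le_norm_imClip_sub c w' _) hc.le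
          (norm_nonneg _))
    · exact continuousOn_const.div
        (continuousOn_const.sub (continuous_ofReal.comp_continuousOn hmu)) fun t _ => hne w _
    · rw [norm_div, Complex.norm_ofNat, Real.coe_toNNReal _ (by positivity)]
      exact div_le_div_of_nonneg_left zero_le_two hc (le_norm_imClip_sub c w _)
    · simp only [sub_zero, sub_self, max_eq_left hT, NNReal.coe_zero]
      rw [Real.coe_toNNReal _ (by positivity), Real.coe_toNNReal _ (by positivity)]
  exact hpl.exists_eq_forall_mem_Icc_hasDerivWithinAt₀

lemma two_div_re (w : ℂ) : (2 / w).re = 2 * w.re / (w.re ^ 2 + w.im ^ 2) := by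
  simp [Complex.div_re, normSq_apply, sq]

lemma two_div_im (w : ℂ) : (2 / w).im = -(2 * w.im / (w.re ^ 2 + w.im ^ 2)) := by
  simp [Complex.div_im, normSq_apply, sq]

/-- A clipped solution moves left as long as it starts to the left of a level that stays below
the driver. -/
lemma re_le_of_lt_driver {mu : ℝ → ℝ} {t₀ c B : ℝ} {g : ℝ → ℂ}
    (hg : ∀ t ∈ Icc 0 t₀,
      HasDerivWithinAt g (2 / (imClip c (g t) - (mu t : ℂ))) (Icc 0 t₀) t)
    (hB : ∀ t ∈ Icc 0 t₀, B < mu t) (h0 : (g 0).re ≤ B) {t : ℝ} (ht : t ∈ Icc 0 t₀) :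
    (g t).re ≤ B := by
  have hd : ∀ t ∈ Icc 0 t₀, HasDerivWithinAt (fun t => (g t).re)
      (2 / (imClip c (g t) - (mu t : ℂ))).re (Icc 0 t₀) t := fun t ht =>
    reCLM.hasFDerivAt.comp_hasDerivWithinAt t (hg t ht)
  refine image_le_of_deriv_right_lt_deriv_boundary
    (HasDerivWithinAt.continuousOn hd)
    (fun x hx => (hd x (Ico_subset_Icc_self hx)).mono_of_mem_nhdsWithin
      (Icc_mem_nhdsGE_of_mem hx)) h0 (fun x => hasDerivAt_const x B) (fun x hx hxB => ?_) ht
  have hlt := hB x (Ico_subset_Icc_self hx)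
  have hxB' : (g x).re - mu x < 0 := by linarith
  rw [two_div_re]
  have hre : (imClip c (g x) - (mu x : ℂ)).re = (g x).re - mu x := by simp [imClip]
  rw [hre]
  have := pow_pos (neg_pos.2 hxB') 2
  rw [neg_sq] at this
  exact div_neg_of_neg_of_pos (by linarith) (by positivity)

/-- Comparison of the imaginary part of a clipped solution with a lower barrier. -/
lemma le_im_of_deriv_barrier {mu b b' : ℝ → ℝ} {t₀ t₁ c : ℝ} {g : ℝ → ℂ}
    (hg : ∀ t ∈ Icc t₀ t₁,
      HasDerivWithinAt g (2 / (imClip c (g t) - (mu t : ℂ))) (Icc t₀ t₁) t)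
    (h0 : b t₀ ≤ (g t₀).im)
    (hb : ∀ t ∈ Icc t₀ t₁, HasDerivAt b (b' t) t)
    (hle : ∀ t ∈ Ico t₀ t₁, b' t ≤ (2 / (imClip c (g t) - (mu t : ℂ))).im)
    {t : ℝ} (ht : t ∈ Icc t₀ t₁) : b t ≤ (g t).im := by
  have hd : ∀ t ∈ Icc t₀ t₁, HasDerivWithinAt (fun t => (g t).im)
      (2 / (imClip c (g t) - (mu t : ℂ))).im (Icc t₀ t₁) t := fun t ht =>
    imCLM.hasFDerivAt.comp_hasDerivWithinAt t (hg t ht)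
  exact image_le_of_deriv_right_le_deriv_boundary
    (fun t ht => (hb t ht).continuousAt.continuousWithinAt)
    (fun x hx => (hb x (Ico_subset_Icc_self hx)).hasDerivWithinAt) h0
    (HasDerivWithinAt.continuousOn hd)
    (fun x hx => (hd x (Ico_subset_Icc_self hx)).mono_of_mem_nhdsWithin
      (Icc_mem_nhdsGE_of_mem hx)) hle ht

lemma neg_two_div_le_two_div_im {c : ℝ} (hc : 0 < c) (w : ℂ) (x : ℝ) :
    -(2 / c) ≤ (2 / (imClip c w - (x : ℂ))).im := by
  refine (neg_le_neg ?_).trans (neg_abs_le _)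
  refine (abs_im_le_norm _).trans ?_
  rw [norm_div, Complex.norm_ofNat]
  exact div_le_div_of_nonneg_left zero_le_two hc (le_norm_imClip_sub c w _)

lemma neg_one_div_le_two_div_im {d : ℝ} (hd : 0 < d) {w : ℂ} (hw : w.re ≤ -d) :
    -(1 / d) ≤ (2 / w).im := by
  rw [two_div_im, neg_le_neg_iff]
  have hpos : 0 < w.re ^ 2 + w.im ^ 2 := by nlinarith
  rw [div_le_div_iff₀ hpos hd]
  nlinarith [sq_nonneg (d - w.im)]

lemma survives_of_le_im {mu : ℝ → ℝ} {T c : ℝ} (hc : 0 < c) {g : ℝ → ℂ}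
    (hg : ∀ t ∈ Icc 0 T,
      HasDerivWithinAt g (2 / (imClip c (g t) - (mu t : ℂ))) (Icc 0 T) t)
    (him : ∀ t ∈ Icc 0 T, c ≤ (g t).im) : Survives mu T (g 0) := by
  refine ⟨g, rfl, HasDerivWithinAt.continuousOn hg, fun t ht => ⟨fun h => ?_, ?_⟩⟩
  · have := him t ht
    rw [h, ofReal_im] at this
    linarith
  · have hclip : imClip c (g t) = g t := by
      simp [imClip, him t ht]
    simpa only [hclip] using hg t ht

/-- If `0 < T ≤ 1`, `0 < q ≤ 1` and `0 < r ≤ 1/2`, then `q √T ≤ u ^ r` for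
`u ≥ (q T ^ (1 - r)) ^ 2`. -/
lemma mul_sqrt_le_rpow {q T r u : ℝ} (hq : 0 < q) (hq1 : q ≤ 1) (hT : 0 < T) (hT1 : T ≤ 1)
    (hr : 0 < r) (hr2 : r ≤ 1 / 2) (hu : (q * T ^ (1 - r)) ^ 2 ≤ u) : q * √T ≤ u ^ r := by
  refine le_trans ?_ (Real.rpow_le_rpow (sq_nonneg _) hu hr.le)
  rw [← Real.rpow_natCast, ← Real.rpow_mul (by positivity),
    Real.mul_rpow hq.le (by positivity), ← Real.rpow_mul hT.le, Real.sqrt_eq_rpow]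
  refine mul_le_mul ?_ ?_ (by positivity) (by positivity)
  · exact Real.self_le_rpow_of_le_one hq.le hq1 (by push_cast; linarith)
  · exact Real.rpow_le_rpow_of_exponent_ge hT hT1 (by push_cast; nlinarith [sq_nonneg (1 - 2 * r)])

lemma survives_of_mul_rpow_le {a r T : ℝ} (ha : 4 ≤ a) (hr : 0 < r) (hr2 : r < 1 / 2)
    (hT : 0 < T) (hT1 : T ≤ 1) {mu : ℝ → ℝ} (hmu : ContinuousOn mu (Icc 0 T))
    (hlow : ∀ t ∈ Icc 0 T, a * (T - t) ^ r ≤ mu t) {z : ℂ} (hre : z.re ≤ 2 * √T)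
    (him : 26 / a * T ^ (1 - r) ≤ z.im) : Survives mu T z := by
  have ha0 : 0 < a := by linarith
  set p : ℝ := T ^ (1 - r) / a with hp
  have hp0 : 0 < p := by positivity
  have hpT : T ^ (1 - r) = a * p := by rw [hp]; field_simp
  have hsT : 0 < √T := Real.sqrt_pos.2 hT
  set t₀ : ℝ := T - (4 * p) ^ 2 with ht₀
  have hq : (4 / a * T ^ (1 - r)) ^ 2 = (4 * p) ^ 2 := by rw [hpT]; field_simp
  have hq1 : 4 / a ≤ 1 := (div_le_one ha0).2 ha
  have ht₀0 : 0 ≤ t₀ := by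
    have h1 : 4 * p ≤ √T := by
      calc 4 * p = 4 / a * T ^ (1 - r) := by rw [hp]; ring
        _ ≤ 1 * T ^ (1 / 2 : ℝ) := by
          gcongr ?_ * ?_
          exact Real.rpow_le_rpow_of_exponent_ge hT hT1 (by linarith)
        _ = √T := by rw [one_mul, Real.sqrt_eq_rpow]
    have := pow_le_pow_left₀ (by positivity) h1 2
    rw [Real.sq_sqrt hT.le] at this
    linarith
  have ht₀T : t₀ < T := by have : 0 < (4 * p) ^ 2 := by positivity
                           linarith
  have hpow : ∀ t ∈ Icc 0 t₀, 4 * √T ≤ a * (T - t) ^ r := by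
    intro t ht
    have h := mul_sqrt_le_rpow (by positivity) hq1 hT hT1 hr hr2.le
      (show (4 / a * T ^ (1 - r)) ^ 2 ≤ T - t by rw [hq]; linarith [ht.2])
    calc 4 * √T = a * (4 / a * √T) := by field_simp
      _ ≤ _ := by gcongr
  obtain ⟨g, rfl, hg⟩ := exists_clipped_solution hT.le (c := 2 * p) (by positivity) hmu z
  have hsub : Icc 0 t₀ ⊆ Icc 0 T := Icc_subset_Icc_right ht₀T.le
  have hg₀ := fun t ht => (hg t (hsub ht)).mono hsub
  have hX : ∀ t ∈ Icc 0 t₀, (g t).re ≤ 2 * √T := fun t ht =>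
    re_le_of_lt_driver hg₀
      (fun t ht => by linarith [hpow t ht, hlow t (hsub ht)]) hre ht
  have hY : ∀ t ∈ Icc 0 t₀, 22 * p ≤ (g t).im := by
    intro t ht
    have hder : ∀ t ∈ Icc 0 t₀, HasDerivAt
        (fun t => (g 0).im + 2 / (a * (1 - r)) * ((T - t) ^ (1 - r) - T ^ (1 - r)))
        (-(1 / (a * (T - t) ^ r / 2))) t := by
      intro t ht
      have hTt : 0 < T - t := by linarith [ht.2]
      have h1 : HasDerivAt (fun t => (T - t) ^ (1 - r))
          (-1 * (1 - r) * (T - t) ^ (1 - r - 1)) t :=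
        ((hasDerivAt_id t).const_sub T).rpow_const (Or.inl hTt.ne')
      convert! ((h1.sub_const (T ^ (1 - r))).const_mul (2 / (a * (1 - r)))).const_add _ using 1
      rw [show 1 - r - 1 = -r by ring, Real.rpow_neg hTt.le]
      have : 1 - r ≠ 0 := by linarith
      have : (T - t) ^ r ≠ 0 := by positivity
      field_simp
    have hbar := le_im_of_deriv_barrier hg₀ (by simp) hder (fun t ht => ?_) ht
    · refine le_trans ?_ hbar
      have hTt : 0 ≤ (T - t) ^ (1 - r) := Real.rpow_nonneg (by linarith [ht.2]) _
      have h2 : 2 / (a * (1 - r)) ≤ 4 / a := by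
        rw [div_le_div_iff₀ (mul_pos ha0 (by linarith)) ha0]
        nlinarith
      have h3 : 0 ≤ 2 / (a * (1 - r)) := div_nonneg zero_le_two (mul_nonneg ha0.le (by linarith))
      have h4 : 4 / a * T ^ (1 - r) = 4 * p := by rw [hp]; ring
      have h5 : 26 / a * T ^ (1 - r) = 26 * p := by rw [hp]; ring
      have h6 := mul_le_mul_of_nonneg_right h2 (Real.rpow_nonneg hT.le (1 - r))
      have h7 := mul_nonneg h3 hTt
      rw [mul_sub]
      linarith
    · have ht' := Ico_subset_Icc_self ht
      have hh := hpow t ht'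
      refine neg_one_div_le_two_div_im (by linarith) ?_
      simp only [imClip, sub_re, ofReal_re]
      linarith [hX t ht', hlow t (hsub ht')]
  refine survives_of_le_im (by positivity) hg fun t ht => ?_
  rcases le_total t t₀ with h | h
  · linarith [hY t ⟨ht.1, h⟩]
  · have hsub' : Icc t₀ T ⊆ Icc 0 T := Icc_subset_Icc_left ht₀0
    have hder : ∀ t ∈ Icc t₀ T, HasDerivAt
        (fun t => 22 * p + -(2 / (2 * p)) * (t - t₀)) (-(2 / (2 * p))) t := fun t _ => by
      simpa using (((hasDerivAt_id t).sub_const t₀).const_mul (-(2 / (2 * p)))).const_add (22 * p)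
    have hbar := le_im_of_deriv_barrier (fun t ht => (hg t (hsub' ht)).mono hsub')
      (by simpa using hY t₀ ⟨ht₀0, le_rfl⟩) hder
      (fun t _ => neg_two_div_le_two_div_im (by positivity) _ _) ⟨h, ht.2⟩
    refine le_trans ?_ hbar
    have h1 : 2 / (2 * p) * (t - t₀) ≤ 16 * p := by
      calc 2 / (2 * p) * (t - t₀) ≤ 2 / (2 * p) * (4 * p) ^ 2 := by
            gcongr
            linarith [ht.2]
        _ = 16 * p := by field_simp; norm_num
    linarith

/-- first part of Lemma 3.3: the mapped-down hull
`K̂ = g_s(K₁ \ K_s)`, realized as the hull driven by the shifted driver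
`t ↦ lam (s + t)` at time `1 - s`, avoids
`(-∞, 2√(1-s)] × [26 a⁻¹ (1-s)^{1-r}, ∞)`. -/
theorem stmt6 (a r : ℝ) (ha : 4 ≤ a) (hr : r ∈ Ioo (0:ℝ) (1/2))
    (lam : ℝ → ℝ) (hcont : ContinuousOn lam (Icc 0 1)) (h1 : lam 1 = 0)
    (hlow : ∀ t ∈ Icc (0:ℝ) 1, a * (1 - t) ^ r ≤ lam t)
    (s : ℝ) (hs : s ∈ Ico (0:ℝ) 1) :
    (LoewnerHull (fun t => lam (s + t)) (1 - s) ∩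
        {z : ℂ | z.re ≤ 2 * Real.sqrt (1 - s) ∧ 26 / a * (1 - s) ^ (1 - r) ≤ z.im} = ∅) ∧
      ∀ z : ℂ, 0 ≤ z.im → z.re ≤ 2 * Real.sqrt (1 - s) →
        26 / a * (1 - s) ^ (1 - r) ≤ z.im →
        Survives (fun t => lam (s + t)) (1 - s) z := by
  have hsurv : ∀ z : ℂ, z.re ≤ 2 * Real.sqrt (1 - s) →
      26 / a * (1 - s) ^ (1 - r) ≤ z.im → Survives (fun t => lam (s + t)) (1 - s) z := by
    intro z hre him
    have hmem : ∀ t ∈ Icc 0 (1 - s), s + t ∈ Icc (0 : ℝ) 1 := fun t ht =>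
      ⟨add_nonneg hs.1 ht.1, by linarith [ht.2]⟩
    refine survives_of_mul_rpow_le ha hr.1 hr.2 (by linarith [hs.2]) (by linarith [hs.1])
      (hcont.comp (by fun_prop) hmem) (fun t ht => ?_) hre him
    rw [sub_sub]
    exact hlow _ (hmem t ht)
  refine ⟨?_, fun z _ => hsurv z⟩
  rw [Set.eq_empty_iff_forall_notMem]
  rintro z ⟨⟨_, hz⟩, hre, him⟩
  exact hz (hsurv z hre him)
end
end

section
/- Let r ∈ (0, 1/2), a ≥ 4, and s ∈ (0,1). Let ξ : [0,s] → ℝ be continuous with ξ(t) ≥ a(1−s+t)^r for all t ∈ [0,s]. Let x, y : [0,s] → ℝ be differentiable with y(t) > 0 for all t, satisfying the upward Loewner flow equations x'(t) = 2(ξ(t) − x(t))/((ξ(t) − x(t))² + y(t)²) and y'(t) = 2y(t)/((ξ(t) − x(t))² + y(t)²). If x(0) ≤ 2√(1−s), then x(t) ≤ 2√(1−s+t) for all t ∈ [0,s]. -/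
open Set Complex Filter

noncomputable section

/-- Lemma 3.4 (i): along the upward Loewner flow with driver
bounded below by `a(1-s+t)^r`, if `x 0 ≤ 2√(1-s)` then
`x t ≤ 2√(1-s+t)` for all `t ∈ [0,s]`. -/
theorem stmt8 (r a s : ℝ) (hr : r ∈ Ioo (0:ℝ) (1/2)) (ha : 4 ≤ a)
    (hs : s ∈ Ioo (0:ℝ) 1) (ξ x y : ℝ → ℝ)
    (hξc : ContinuousOn ξ (Icc 0 s))
    (hξ : ∀ t ∈ Icc (0:ℝ) s, a * (1 - s + t) ^ r ≤ ξ t)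
    (hy : ∀ t ∈ Icc (0:ℝ) s, 0 < y t)
    (hx' : ∀ t ∈ Icc (0:ℝ) s, HasDerivWithinAt x
      (2 * (ξ t - x t) / ((ξ t - x t) ^ 2 + (y t) ^ 2)) (Icc 0 s) t)
    (hy' : ∀ t ∈ Icc (0:ℝ) s, HasDerivWithinAt y
      (2 * y t / ((ξ t - x t) ^ 2 + (y t) ^ 2)) (Icc 0 s) t)
    (hx0 : x 0 ≤ 2 * Real.sqrt (1 - s)) :
    ∀ t ∈ Icc (0:ℝ) s, x t ≤ 2 * Real.sqrt (1 - s + t) := by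
  have hu : ∀ t ∈ Icc (0 : ℝ) s, 0 < 1 - s + t := fun t ht => by linarith [hs.2, ht.1]
  have hB : ∀ t ∈ Icc (0 : ℝ) s, HasDerivAt (fun t => 2 * Real.sqrt (1 - s + t))
      (1 / Real.sqrt (1 - s + t)) t := fun t ht => by
    have hpos := Real.sqrt_pos.2 (hu t ht)
    refine ((((hasDerivAt_id t).const_add (1 - s)).sqrt (hu t ht).ne').const_mul 2).congr_deriv ?_
    simp only [id]
    field_simp
  intro t ht
  refine image_le_of_deriv_right_lt_deriv_boundary'
    (B := fun t => 2 * Real.sqrt (1 - s + t)) (B' := fun t => 1 / Real.sqrt (1 - s + t))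
    (fun t ht => (hx' t ht).continuousWithinAt)
    (fun t ht => (hx' t (Ico_subset_Icc_self ht)).mono_of_mem_nhdsWithin
      (mem_of_superset (Icc_mem_nhdsGE ht.2) (Icc_subset_Icc_left ht.1)))
    (by simpa using hx0)
    (fun t ht => (hB t ht).continuousAt.continuousWithinAt)
    (fun t ht => (hB t (Ico_subset_Icc_self ht)).hasDerivWithinAt) ?_ ht
  intro t ht hxt
  replace ht := Ico_subset_Icc_self ht
  have hw : 0 < Real.sqrt (1 - s + t) := Real.sqrt_pos.2 (hu t ht)
  have hpow : Real.sqrt (1 - s + t) ≤ (1 - s + t) ^ r := by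
    rw [Real.sqrt_eq_rpow]
    exact Real.rpow_le_rpow_of_exponent_ge (hu t ht) (by linarith [ht.2]) hr.2.le
  have hgap : 2 * Real.sqrt (1 - s + t) ≤ ξ t - x t := by
    have := hξ t ht
    nlinarith
  have hy0 := hy t ht
  rw [div_lt_div_iff₀ (by positivity) hw]
  nlinarith [mul_nonneg (hw.le.trans (by linarith : _ ≤ ξ t - x t)) (sub_nonneg.2 hgap),
    pow_pos hy0 2]
end
end

section
/- Let r ∈ (0, 1/2), a ≥ 2 + 2/√(1−2r) (note this forces a ≥ 4), and s ∈ (0,1). Let ξ : [0,s] → ℝ be continuous with ξ(t) ≥ a(1−s+t)^r for all t ∈ [0,s]. Let x, y : [0,s] → ℝ be differentiable with y(t) > 0 for all t, satisfying x'(t) = 2(ξ(t) − x(t))/((ξ(t) − x(t))² + y(t)²) and y'(t) = 2y(t)/((ξ(t) − x(t))² + y(t)²). If x(0) ≤ 2√(1−s), then y(t) ≤ 2y(0) for all t ∈ [0,s]. -/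
open Set Complex Filter

noncomputable section

/-- A derivative within `[u, v]` gives a right derivative at points of `[u, v)`. -/
theorem HasDerivWithinAt.Ici_of_Icc {f : ℝ → ℝ} {f' u v t : ℝ}
    (h : HasDerivWithinAt f f' (Icc u v) t) (ht : t ∈ Ico u v) :
    HasDerivWithinAt f f' (Ici t) t :=
  h.mono_of_mem_nhdsWithin (Icc_mem_nhdsGE_of_mem ht)

theorem Real.sqrt_le_rpow_of_le_half {τ r : ℝ} (h0 : 0 < τ) (h1 : τ ≤ 1) (hr : r ≤ 1 / 2) :
    √τ ≤ τ ^ r := by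
  rw [Real.sqrt_eq_rpow]
  exact Real.rpow_le_rpow_of_exponent_ge h0 h1 hr

theorem Real.exp_half_le_two : Real.exp (1 / 2) ≤ 2 := by
  have h : Real.exp (1 / 2) ^ 2 = Real.exp 1 := by
    rw [← Real.exp_nat_mul]
    norm_num
  nlinarith [Real.exp_one_lt_d9, Real.exp_pos (1 / 2 : ℝ)]

/-- If `x` solves the real part of the upward Loewner flow with `ξ t ≥ a √(1 - s + t)`, `a > 4`,
then the bound `x ≤ 2 √(1 - s + t)` propagates from time `0`. -/
theorem upwardLoewner_re_le {a s : ℝ} (ha : 4 < a) (hs : s < 1) {ξ x y : ℝ → ℝ}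
    (hξ : ∀ t ∈ Icc (0:ℝ) s, a * √(1 - s + t) ≤ ξ t)
    (hx' : ∀ t ∈ Icc (0:ℝ) s, HasDerivWithinAt x
      (2 * (ξ t - x t) / ((ξ t - x t) ^ 2 + (y t) ^ 2)) (Icc 0 s) t)
    (hx0 : x 0 ≤ 2 * √(1 - s)) :
    ∀ t ∈ Icc (0:ℝ) s, x t ≤ 2 * √(1 - s + t) := by
  have hB : ∀ t ∈ Ico (0:ℝ) s,
      HasDerivWithinAt (fun t => 2 * √(1 - s + t)) (1 / √(1 - s + t)) (Ici t) t := by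
    intro t ht
    have hτ : 0 < 1 - s + t := by linarith [ht.1]
    have h := ((((hasDerivAt_id t).const_add (1 - s)).sqrt hτ.ne').const_mul 2).hasDerivWithinAt
      (s := Ici t)
    refine h.congr_deriv ?_
    simp only [id]
    field_simp
  refine image_le_of_deriv_right_lt_deriv_boundary'
    (fun t ht => (hx' t ht).continuousWithinAt)
    (fun t ht => (hx' t (Ico_subset_Icc_self ht)).Ici_of_Icc ht) (by simpa using hx0)
    (by fun_prop) hB ?_
  intro t ht hxt
  have hτ : 0 < √(1 - s + t) := Real.sqrt_pos.2 (by linarith [ht.1])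
  have hd : 2 * √(1 - s + t) < ξ t - x t := by
    nlinarith [hξ t (Ico_subset_Icc_self ht)]
  rw [div_lt_div_iff₀ (by nlinarith [sq_nonneg (y t)]) hτ]
  nlinarith [sq_nonneg (y t)]

/-- Lemma 3.4 (ii): along the upward Loewner flow with driver
bounded below by `a(1-s+t)^r` and `a ≥ 2 + 2/√(1-2r)`, if
`x 0 ≤ 2√(1-s)` then `y t ≤ 2 y 0` for all `t ∈ [0,s]`. -/
theorem stmt9 (r a s : ℝ) (hr : r ∈ Ioo (0:ℝ) (1/2))
    (ha : 2 + 2 / Real.sqrt (1 - 2 * r) ≤ a)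
    (hs : s ∈ Ioo (0:ℝ) 1) (ξ x y : ℝ → ℝ)
    (hξc : ContinuousOn ξ (Icc 0 s))
    (hξ : ∀ t ∈ Icc (0:ℝ) s, a * (1 - s + t) ^ r ≤ ξ t)
    (hy : ∀ t ∈ Icc (0:ℝ) s, 0 < y t)
    (hx' : ∀ t ∈ Icc (0:ℝ) s, HasDerivWithinAt x
      (2 * (ξ t - x t) / ((ξ t - x t) ^ 2 + (y t) ^ 2)) (Icc 0 s) t)
    (hy' : ∀ t ∈ Icc (0:ℝ) s, HasDerivWithinAt y
      (2 * y t / ((ξ t - x t) ^ 2 + (y t) ^ 2)) (Icc 0 s) t)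
    (hx0 : x 0 ≤ 2 * Real.sqrt (1 - s)) :
    ∀ t ∈ Icc (0:ℝ) s, y t ≤ 2 * y 0 := by
  have h2r : 0 < 1 - 2 * r := by linarith [hr.2]
  have hc : 0 < √(1 - 2 * r) := Real.sqrt_pos.2 h2r
  have hc2 : √(1 - 2 * r) ^ 2 = 1 - 2 * r := Real.sq_sqrt h2r.le
  have hc1 : √(1 - 2 * r) < 1 := by nlinarith [hr.1]
  have hb : 2 < 2 / √(1 - 2 * r) := by
    rw [lt_div_iff₀ hc]
    linarith
  have hτ0 : ∀ t ∈ Icc (0:ℝ) s, 0 < 1 - s + t := fun t ht => by linarith [ht.1, hs.2]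
  have hsqrt : ∀ t ∈ Icc (0:ℝ) s, √(1 - s + t) ≤ (1 - s + t) ^ r := fun t ht =>
    Real.sqrt_le_rpow_of_le_half (hτ0 t ht) (by linarith [ht.2]) hr.2.le
  have hx := upwardLoewner_re_le (a := a) (by linarith) hs.2
    (fun t ht => (mul_le_mul_of_nonneg_left (hsqrt t ht) (by linarith)).trans (hξ t ht)) hx' hx0
  have hrate : ∀ t ∈ Icc (0:ℝ) s,
      2 * y t / ((ξ t - x t) ^ 2 + y t ^ 2) / y t ≤ (1 - 2 * r) / 2 * (1 - s + t) ^ (-(2 * r)) := by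
    intro t ht
    have hp : 0 < (1 - s + t) ^ r := Real.rpow_pos_of_pos (hτ0 t ht) r
    have hd : 2 / √(1 - 2 * r) * (1 - s + t) ^ r ≤ ξ t - x t := by
      nlinarith [hξ t ht, hx t ht, hsqrt t ht]
    have hsq : (2 / √(1 - 2 * r) * (1 - s + t) ^ r) ^ 2 ≤ (ξ t - x t) ^ 2 + y t ^ 2 :=
      (pow_le_pow_left₀ (by positivity) hd 2).trans (by nlinarith [sq_nonneg (y t)])
    have hpow : (1 - s + t) ^ (-(2 * r)) = 1 / ((1 - s + t) ^ r) ^ 2 := by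
      rw [Real.rpow_neg (hτ0 t ht).le, mul_comm, Real.rpow_mul (hτ0 t ht).le, one_div]
      norm_num
    have hy0 := hy t ht
    calc 2 * y t / ((ξ t - x t) ^ 2 + y t ^ 2) / y t
        = 2 / ((ξ t - x t) ^ 2 + y t ^ 2) := by field_simp
      _ ≤ 2 / (2 / √(1 - 2 * r) * (1 - s + t) ^ r) ^ 2 :=
          div_le_div_of_nonneg_left (by norm_num) (by positivity) hsq
      _ = (1 - 2 * r) / 2 * (1 - s + t) ^ (-(2 * r)) := by
          rw [hpow, mul_pow, div_pow, hc2]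
          field_simp
  have hlog : ∀ t ∈ Icc (0:ℝ) s, Real.log (y t) ≤
      Real.log (y 0) + ((1 - s + t) ^ (1 - 2 * r) - (1 - s) ^ (1 - 2 * r)) / 2 := by
    have hB : ∀ t ∈ Icc (0:ℝ) s, HasDerivAt
        (fun t => Real.log (y 0) + ((1 - s + t) ^ (1 - 2 * r) - (1 - s) ^ (1 - 2 * r)) / 2)
        ((1 - 2 * r) / 2 * (1 - s + t) ^ (-(2 * r))) t := by
      intro t ht
      have h := (((((hasDerivAt_id t).const_add (1 - s)).rpow_const (p := 1 - 2 * r)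
        (Or.inl (hτ0 t ht).ne')).sub_const ((1 - s) ^ (1 - 2 * r))).div_const 2).const_add
        (Real.log (y 0))
      refine h.congr_deriv ?_
      rw [show 1 - 2 * r - 1 = -(2 * r) by ring]
      simp only [id]
      ring
    have hL : ∀ t ∈ Icc (0:ℝ) s, HasDerivWithinAt (fun t => Real.log (y t))
        (2 * y t / ((ξ t - x t) ^ 2 + y t ^ 2) / y t) (Icc 0 s) t :=
      fun t ht => (hy' t ht).log (hy t ht).ne'
    exact image_le_of_deriv_right_le_deriv_boundary
      (fun t ht => (hL t ht).continuousWithinAt)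
      (fun t ht => (hL t (Ico_subset_Icc_self ht)).Ici_of_Icc ht) (by simp)
      (fun t ht => (hB t ht).continuousAt.continuousWithinAt)
      (fun t ht => (hB t (Ico_subset_Icc_self ht)).hasDerivWithinAt)
      (fun t ht => hrate t (Ico_subset_Icc_self ht))
  intro t ht
  have hy0 : 0 < y 0 := hy 0 ⟨le_rfl, hs.1.le⟩
  have h1 : (1 - s + t) ^ (1 - 2 * r) ≤ 1 :=
    Real.rpow_le_one (hτ0 t ht).le (by linarith [ht.2]) h2r.le
  have h2 : 0 ≤ (1 - s) ^ (1 - 2 * r) := Real.rpow_nonneg (by linarith [hs.2]) _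
  calc y t = Real.exp (Real.log (y t)) := (Real.exp_log (hy t ht)).symm
    _ ≤ Real.exp (1 / 2 + Real.log (y 0)) := Real.exp_le_exp.2 (by linarith [hlog t ht])
    _ = Real.exp (1 / 2) * y 0 := by rw [Real.exp_add, Real.exp_log hy0]
    _ ≤ 2 * y 0 := mul_le_mul_of_nonneg_right Real.exp_half_le_two hy0.le
end
end

section
/- Let r ∈ (0, 1/2), a ≥ max(15, 2 + 2/√(1−2r)), and s ∈ (0,1). Let ξ : [0,s] → ℝ be continuous with ξ(t) ≥ a(1−s+t)^r for all t ∈ [0,s]. Let x, y : [0,s] → ℝ be differentiable with y(t) > 0, satisfying x'(t) = 2(ξ(t) − x(t))/((ξ(t) − x(t))² + y(t)²) and y'(t) = 2y(t)/((ξ(t) − x(t))² + y(t)²), and let p : [0,s] → ℝ be differentiable with p(t) < ξ(t) for all t and p'(t) = 2/(ξ(t) − p(t)) (the upward flow of a real point). If p(0) + √(1−s) ≤ x(0) ≤ 2√(1−s) and 0 < y(0) < 26·a^{−1}·(1−s)^{1−r}, then x(t) − p(t) ≥ x(0) − p(0) for all t ∈ [0,s]. -/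
open Set Complex Filter

noncomputable section

/-- A strict barrier principle on `[0, s]`: `f` stays below `B` if it starts below `B` and its
derivative is smaller than that of `B` wherever the two functions meet. -/
theorem le_of_hasDerivWithinAt_lt_of_eq {s : ℝ} {f f' B B' : ℝ → ℝ}
    (hf : ∀ t ∈ Icc (0:ℝ) s, HasDerivWithinAt f (f' t) (Icc 0 s) t)
    (hB : ∀ t ∈ Icc (0:ℝ) s, HasDerivWithinAt B (B' t) (Icc 0 s) t)
    (h0 : f 0 ≤ B 0) (hlt : ∀ t ∈ Icc (0:ℝ) s, f t = B t → f' t < B' t) :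
    ∀ t ∈ Icc (0:ℝ) s, f t ≤ B t := by
  have right {g : ℝ → ℝ} {c t : ℝ} (ht : t ∈ Ico (0:ℝ) s)
      (hg : HasDerivWithinAt g c (Icc 0 s) t) : HasDerivWithinAt g c (Ici t) t :=
    hg.mono_of_mem_nhdsWithin (Icc_mem_nhdsGE_of_mem ht)
  exact fun t ht => image_le_of_deriv_right_lt_deriv_boundary'
    (fun t ht => (hf t ht).continuousWithinAt)
    (fun t ht => right ht (hf t (Ico_subset_Icc_self ht))) h0
    (fun t ht => (hB t ht).continuousWithinAt)
    (fun t ht => right ht (hB t (Ico_subset_Icc_self ht)))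
    (fun t ht => hlt t (Ico_subset_Icc_self ht)) ht

/-- Lemma 3.4 (iii): along the upward Loewner flow, the gap
between the flow of a point of the half-plane and the flow of a real point
does not decrease. -/
theorem stmt10 (r a s : ℝ) (hr : r ∈ Ioo (0:ℝ) (1/2))
    (ha : max 15 (2 + 2 / Real.sqrt (1 - 2 * r)) ≤ a)
    (hs : s ∈ Ioo (0:ℝ) 1) (ξ x y p : ℝ → ℝ)
    (hξc : ContinuousOn ξ (Icc 0 s))
    (hξ : ∀ t ∈ Icc (0:ℝ) s, a * (1 - s + t) ^ r ≤ ξ t)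
    (hy : ∀ t ∈ Icc (0:ℝ) s, 0 < y t)
    (hx' : ∀ t ∈ Icc (0:ℝ) s, HasDerivWithinAt x
      (2 * (ξ t - x t) / ((ξ t - x t) ^ 2 + (y t) ^ 2)) (Icc 0 s) t)
    (hy' : ∀ t ∈ Icc (0:ℝ) s, HasDerivWithinAt y
      (2 * y t / ((ξ t - x t) ^ 2 + (y t) ^ 2)) (Icc 0 s) t)
    (hp : ∀ t ∈ Icc (0:ℝ) s, p t < ξ t)
    (hp' : ∀ t ∈ Icc (0:ℝ) s, HasDerivWithinAt p (2 / (ξ t - p t)) (Icc 0 s) t)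
    (hx0l : p 0 + Real.sqrt (1 - s) ≤ x 0) (hx0u : x 0 ≤ 2 * Real.sqrt (1 - s))
    (hy0l : 0 < y 0) (hy0u : y 0 < 26 / a * (1 - s) ^ (1 - r)) :
    ∀ t ∈ Icc (0:ℝ) s, x 0 - p 0 ≤ x t - p t := by
  obtain ⟨hr0, hr1⟩ := hr
  obtain ⟨hs0, hs1⟩ := hs
  have ha15 : (15:ℝ) ≤ a := (le_max_left _ _).trans ha
  have hq : 0 < 1 - 2 * r := by linarith
  have ha2 : 4 ≤ (a - 2) ^ 2 * (1 - 2 * r) := by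
    have h1 : 2 / √(1 - 2 * r) ≤ a - 2 := by linarith [(le_max_right _ _).trans ha]
    have h2 := Real.sqrt_pos.2 hq
    rw [div_le_iff₀ h2] at h1
    calc (4:ℝ) = 2 ^ 2 := by norm_num
      _ ≤ ((a - 2) * √(1 - 2 * r)) ^ 2 := by gcongr
      _ = _ := by rw [mul_pow, Real.sq_sqrt hq.le]
  have hT : ∀ t ∈ Icc (0:ℝ) s, 0 < 1 - s + t ∧ 1 - s + t ≤ 1 := fun t ht =>
    ⟨by linarith [ht.1], by linarith [ht.2]⟩
  have hsqrt : ∀ t ∈ Icc (0:ℝ) s, √(1 - s + t) ≤ (1 - s + t) ^ r := fun t ht => by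
    rw [Real.sqrt_eq_rpow]
    exact Real.rpow_le_rpow_of_exponent_ge (hT t ht).1 (hT t ht).2 hr1.le
  have hdT : ∀ t, HasDerivAt (fun t : ℝ => 1 - s + t) 1 t := fun t =>
    (hasDerivAt_id t).const_add (1 - s)
  have hxle : ∀ t ∈ Icc (0:ℝ) s, x t ≤ 2 * √(1 - s + t) := by
    refine le_of_hasDerivWithinAt_lt_of_eq hx'
      (fun t ht => (((hdT t).sqrt (hT t ht).1.ne').const_mul 2).hasDerivWithinAt)
      (by simpa using hx0u) fun t ht hxt => ?_
    have hS := Real.sqrt_pos.2 (hT t ht).1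
    have hu : 13 * √(1 - s + t) ≤ ξ t - x t := by
      nlinarith [hξ t ht, hsqrt t ht]
    have hu0 : 0 < ξ t - x t := by linarith
    rw [mul_one_div, div_lt_div_iff₀ (by positivity) (by positivity)]
    nlinarith [sq_nonneg (y t), mul_le_mul_of_nonneg_right hu hu0.le, mul_pos hS hu0]
  have hu : ∀ t ∈ Icc (0:ℝ) s, (a - 2) * (1 - s + t) ^ r ≤ ξ t - x t := fun t ht => by
    linarith [hξ t ht, hsqrt t ht, hxle t ht]
  have hylog : ∀ t ∈ Icc (0:ℝ) s, Real.log (y t) ≤ Real.log (y 0) + 1 / 2 := by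
    have hd : ∀ t ∈ Icc (0:ℝ) s, HasDerivWithinAt
        (fun t => Real.log (y t) - 1 / 2 * (1 - s + t) ^ (1 - 2 * r))
        (2 * y t / ((ξ t - x t) ^ 2 + y t ^ 2) / y t -
          1 / 2 * (1 * (1 - 2 * r) * (1 - s + t) ^ (1 - 2 * r - 1))) (Icc 0 s) t := fun t ht =>
      ((hy' t ht).log (hy t ht).ne').sub
        (((hdT t).rpow_const (.inl (hT t ht).1.ne')).const_mul _).hasDerivWithinAt
    have hanti : AntitoneOn (fun t => Real.log (y t) - 1 / 2 * (1 - s + t) ^ (1 - 2 * r))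
        (Icc 0 s) := by
      refine antitoneOn_of_hasDerivWithinAt_nonpos (convex_Icc 0 s)
        (fun t ht => (hd t ht).continuousWithinAt)
        (fun t ht => (hd t (interior_subset ht)).mono interior_subset) fun t ht => ?_
      replace ht : t ∈ Icc (0:ℝ) s := interior_subset ht
      have hTr := Real.rpow_pos_of_pos (hT t ht).1 r
      have hpow : (1 - s + t) ^ (1 - 2 * r - 1) = 1 / ((1 - s + t) ^ r) ^ 2 := by
        rw [show 1 - 2 * r - 1 = -(r * (2:ℕ)) by push_cast; ring,
          Real.rpow_neg (hT t ht).1.le, Real.rpow_mul_natCast (hT t ht).1.le, one_div]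
      have hyt := hy t ht
      have hleft : 2 * y t / ((ξ t - x t) ^ 2 + y t ^ 2) / y t =
          2 / ((ξ t - x t) ^ 2 + y t ^ 2) := by
        field_simp
      have hsq : ((a - 2) * (1 - s + t) ^ r) ^ 2 ≤ (ξ t - x t) ^ 2 :=
        pow_le_pow_left₀ (mul_nonneg (by linarith) hTr.le) (hu t ht) 2
      have hprod : 4 * ((1 - s + t) ^ r) ^ 2 ≤
          (1 - 2 * r) * ((ξ t - x t) ^ 2 + y t ^ 2) := by
        calc 4 * ((1 - s + t) ^ r) ^ 2
            ≤ (a - 2) ^ 2 * (1 - 2 * r) * ((1 - s + t) ^ r) ^ 2 := by gcongr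
          _ = (1 - 2 * r) * ((a - 2) * (1 - s + t) ^ r) ^ 2 := by ring
          _ ≤ _ := by
            gcongr
            linarith [sq_nonneg (y t)]
      have hright : 1 / 2 * (1 * (1 - 2 * r) * (1 / ((1 - s + t) ^ r) ^ 2)) =
          (1 - 2 * r) / (2 * ((1 - s + t) ^ r) ^ 2) := by
        field_simp
      rw [hpow, hleft, hright, sub_nonpos, div_le_div_iff₀ (by positivity) (by positivity)]
      linarith
    intro t ht
    have h := hanti ⟨le_rfl, hs0.le⟩ ht ht.1
    have h1 := Real.rpow_le_one (hT t ht).1.le (hT t ht).2 hq.le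
    have h2 : 0 ≤ (1 - s + 0) ^ (1 - 2 * r) := Real.rpow_nonneg (by linarith) _
    simp only at h
    linarith
  have hysq : ∀ t ∈ Icc (0:ℝ) s, y t ^ 2 ≤ 3 * y 0 ^ 2 := fun t ht => by
    have hyt := hy t ht
    have h : Real.log (y t ^ 2) ≤ Real.log (Real.exp 1 * y 0 ^ 2) := by
      rw [Real.log_mul (Real.exp_pos 1).ne' (by positivity), Real.log_exp, Real.log_pow,
        Real.log_pow]
      push_cast
      linarith [hylog t ht]
    have h' := (Real.log_le_log_iff (by positivity) (by positivity)).1 h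
    have he : Real.exp 1 ≤ 3 := Real.exp_one_lt_three.le
    exact h'.trans (by gcongr)
  have hs' : 0 < 1 - s := by linarith
  have hy0 : 3 * y 0 ^ 2 < (a - 2) * (1 - s) ^ r * √(1 - s) := by
    have hpow : ((1 - s) ^ (1 - r)) ^ 2 ≤ (1 - s) ^ r * √(1 - s) := by
      rw [← Real.rpow_mul_natCast hs'.le, Real.sqrt_eq_rpow, ← Real.rpow_add hs']
      exact Real.rpow_le_rpow_of_exponent_ge hs' (by linarith) (by push_cast; linarith)
    have hsq : y 0 ^ 2 < (26 / a * (1 - s) ^ (1 - r)) ^ 2 :=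
      pow_lt_pow_left₀ hy0u hy0l.le two_ne_zero
    have hc : 3 * (26 / a) ^ 2 ≤ a - 2 := by
      have : 26 / a ≤ 26 / 15 := by gcongr
      have : (26 / a) ^ 2 ≤ (26 / 15) ^ 2 := by gcongr
      linarith
    calc 3 * y 0 ^ 2 < 3 * (26 / a * (1 - s) ^ (1 - r)) ^ 2 := by linarith
      _ = 3 * (26 / a) ^ 2 * ((1 - s) ^ (1 - r)) ^ 2 := by ring
      _ ≤ (a - 2) * ((1 - s) ^ r * √(1 - s)) :=
        mul_le_mul hc hpow (sq_nonneg _) (by linarith)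
      _ = _ := by ring
  refine le_of_hasDerivWithinAt_lt_of_eq
    (fun t _ => hasDerivWithinAt_const t (Icc 0 s) (x 0 - p 0))
    (B := fun t => x t - p t) (fun t ht => (hx' t ht).sub (hp' t ht)) le_rfl fun t ht hD => ?_
  have hS := Real.sqrt_pos.2 hs'
  have hmono : (1 - s) ^ r ≤ (1 - s + t) ^ r :=
    Real.rpow_le_rpow hs'.le (by linarith [ht.1]) hr0.le
  have hut : (a - 2) * (1 - s) ^ r ≤ ξ t - x t :=
    (mul_le_mul_of_nonneg_left hmono (by linarith)).trans (hu t ht)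
  have hu0 : 0 < ξ t - x t :=
    (mul_pos (by linarith) (Real.rpow_pos_of_pos hs' r)).trans_le hut
  have hgap : √(1 - s) ≤ x t - p t := by
    linarith
  have hkey : y t ^ 2 < (ξ t - x t) * (x t - p t) := by
    calc y t ^ 2 ≤ 3 * y 0 ^ 2 := hysq t ht
      _ < (a - 2) * (1 - s) ^ r * √(1 - s) := hy0
      _ ≤ _ := by gcongr
  have hpt : 0 < ξ t - p t := sub_pos.2 (hp t ht)
  rw [sub_pos, div_lt_div_iff₀ hpt (by positivity)]
  nlinarith
end
end
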